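/- Schensted row-bumping monotonicity for restricted rectification: if T is obtained from a pinned properly labeled diagram S by inserting s with landing cell x, and U is obtained from T by subsequently inserting t with landing cell y (both restricted by k), then: (i) if s < t, x lies weakly right of y, and strictly below y if they are in the same column; (ii) if s ≥ t, x lies strictly left of y, and weakly above y if they are in adjacent columns. -/

import Mathlib

/-- A cell `(c, r)` records a column `c ≥ 1` and a row `r ≥ 1`. -/
abbrev Cell : Type := ℕ × ℕ

/-- A diagram is a finite set of cells. -/
abbrev Diagram : Type := Finset Cell

/-- One Kohnert move: the rightmost cell `(c, r)` of some row `r` drops down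
within column `c` to the highest vacant position `(c, r')` with `r' < r`
(remaining in the first quadrant); all other cells are unchanged. -/
def KohnertMove (D E : Diagram) : Prop :=
  ∃ c r r' : ℕ, (c, r) ∈ D ∧
    (∀ c', (c', r) ∈ D → c' ≤ c) ∧
    1 ≤ r' ∧ r' < r ∧ (c, r') ∉ D ∧
    (∀ r'', r' < r'' → r'' < r → (c, r'') ∈ D) ∧
    E = insert (c, r') (D.erase (c, r))

/-- The left-justified composition diagram of `α`, with `α (i+1)` cells in row
`i+1` for `i < n`. -/
def compDiagram (n : ℕ) (α : ℕ → ℕ) : Diagram :=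
  (Finset.range n).biUnion (fun i => (Finset.Icc 1 (α (i+1))).image (fun c => (c, i+1)))

/-- The set of Kohnert diagrams of `α`: all diagrams obtainable from the
composition diagram of `α` by a sequence of Kohnert moves. -/
def KD (n : ℕ) (α : ℕ → ℕ) : Set Diagram :=
  {D | Relation.ReflTransGen KohnertMove (compDiagram n α) D}
/-- A semi-proper labeling `L` of the diagram `D` of shape `α` (a weak
composition, 1-indexed): cells lie in the first quadrant; within each column
`c ≥ 1` the labels are distinct and are exactly the rows `{r ≥ 1 | α r ≥ c}`;
each label in row `r` is at least `r` (flagged); and cells sharing a label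
weakly descend from left to right. -/
def SemiProper (D : Diagram) (α : ℕ → ℕ) (L : Cell → ℕ) : Prop :=
  (∀ p ∈ D, 1 ≤ p.1 ∧ 1 ≤ p.2) ∧
  (∀ c : ℕ, 1 ≤ c →
    Set.InjOn L {p : Cell | p ∈ D ∧ p.1 = c} ∧
    L '' {p : Cell | p ∈ D ∧ p.1 = c} = {r : ℕ | 1 ≤ r ∧ c ≤ α r}) ∧
  (∀ p ∈ D, p.2 ≤ L p) ∧
  (∀ p ∈ D, ∀ q ∈ D, L p = L q → p.1 < q.1 → q.2 ≤ p.2)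

/-- For labels `r < s`, the label `s` touches `r` at column `c`: there is an
`s` in column `c+1` lying weakly below the `r` in column `c`. -/
def TouchesAt (D : Diagram) (L : Cell → ℕ) (r s c : ℕ) : Prop :=
  ∃ p ∈ D, ∃ q ∈ D, p.1 = c ∧ L p = r ∧ q.1 = c + 1 ∧ L q = s ∧ q.2 ≤ p.2

/-- `s` abuts `r` at column `c`: `s` touches `r` at `c` and `s` does not cross
`r`, i.e. no cell labeled `r` lies above the `s` in column `c+1`. -/
def AbutsAt (D : Diagram) (L : Cell → ℕ) (r s c : ℕ) : Prop :=
  TouchesAt D L r s c ∧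
  ∀ q ∈ D, q.1 = c + 1 → L q = s → ∀ p ∈ D, p.1 = c + 1 → L p = r → p.2 ≤ q.2
/-- `ThreadSpec D ts`: the list `ts` of threads is a run of the greedy
threading algorithm on the diagram `D`. Thread `i` is constructed from the set
`U` of cells not threaded by the earlier threads: it starts at the
rightmost-then-lowest cell of `U`; after a cell `x`, the next cell is the
lowest cell of `U` (not already on this thread) in the column immediately left
of `x` lying weakly above `x`; and the thread stops in column `1` or when no
such cell exists.  All cells get threaded. -/
def ThreadSpec (D : Diagram) (ts : List (List Cell)) : Prop :=
  ((ts.flatten).toFinset = D) ∧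
  ∀ i (hi : i < ts.length),
    (ts.get ⟨i, hi⟩ ≠ []) ∧
    (∀ h0 : 0 < (ts.get ⟨i, hi⟩).length,
      ((ts.get ⟨i, hi⟩).get ⟨0, h0⟩ ∈ D \ (((ts.take i).flatten).toFinset) ∧
      ∀ p ∈ D \ (((ts.take i).flatten).toFinset),
        p.1 ≤ ((ts.get ⟨i, hi⟩).get ⟨0, h0⟩).1 ∧
        (p.1 = ((ts.get ⟨i, hi⟩).get ⟨0, h0⟩).1 →
          ((ts.get ⟨i, hi⟩).get ⟨0, h0⟩).2 ≤ p.2))) ∧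
    (∀ j (hj : j + 1 < (ts.get ⟨i, hi⟩).length),
      ((ts.get ⟨i, hi⟩).get ⟨j+1, hj⟩ ∈ D \ (((ts.take i).flatten).toFinset) ∧
       (ts.get ⟨i, hi⟩).get ⟨j+1, hj⟩ ∉ (ts.get ⟨i, hi⟩).take (j+1) ∧
       ((ts.get ⟨i, hi⟩).get ⟨j+1, hj⟩).1 + 1 =
          ((ts.get ⟨i, hi⟩).get ⟨j, Nat.lt_of_succ_lt hj⟩).1 ∧
       ((ts.get ⟨i, hi⟩).get ⟨j, Nat.lt_of_succ_lt hj⟩).2 ≤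
          ((ts.get ⟨i, hi⟩).get ⟨j+1, hj⟩).2 ∧
       (∀ p ∈ D \ (((ts.take i).flatten).toFinset),
         p ∉ (ts.get ⟨i, hi⟩).take (j+1) →
         p.1 + 1 = ((ts.get ⟨i, hi⟩).get ⟨j, Nat.lt_of_succ_lt hj⟩).1 →
         ((ts.get ⟨i, hi⟩).get ⟨j, Nat.lt_of_succ_lt hj⟩).2 ≤ p.2 →
         ((ts.get ⟨i, hi⟩).get ⟨j+1, hj⟩).2 ≤ p.2))) ∧
    (∀ hne : ts.get ⟨i, hi⟩ ≠ [],
      ((ts.get ⟨i, hi⟩).getLast hne).1 = 1 ∨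
      ¬ ∃ p ∈ D \ (((ts.take i).flatten).toFinset), p ∉ ts.get ⟨i, hi⟩ ∧
          p.1 + 1 = ((ts.get ⟨i, hi⟩).getLast hne).1 ∧
          ((ts.get ⟨i, hi⟩).getLast hne).2 ≤ p.2)
/-- A left swap on 1-indexed weak compositions `ℕ → ℕ`. -/
def LeftSwapStepN (β α : ℕ → ℕ) : Prop :=
  ∃ i j : ℕ, 1 ≤ i ∧ i < j ∧ β i < β j ∧ α = fun l => β (Equiv.swap i j l)

/-- `α ⪯ β` for 1-indexed weak compositions. -/
def LSwapLE (α β : ℕ → ℕ) : Prop :=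
  Relation.ReflTransGen LeftSwapStepN β α

/-- A pinned left swap (both parts nonzero) on 1-indexed weak compositions. -/
def PinnedSwapStepN (β α : ℕ → ℕ) : Prop :=
  ∃ i j : ℕ, 1 ≤ i ∧ i < j ∧ 0 < β i ∧ β i < β j ∧ α = fun l => β (Equiv.swap i j l)

/-- `α ⪯⁰ β` for 1-indexed weak compositions. -/
def PinnedSwapLE (α β : ℕ → ℕ) : Prop :=
  Relation.ReflTransGen PinnedSwapStepN β α

/-- A labeling is pinned if each entry in column 1 equals its row. -/
def IsPinned (D : Diagram) (L : Cell → ℕ) : Prop :=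
  ∀ p ∈ D, p.1 = 1 → L p = p.2

/-- A vacant position `x` (in column `x.1 = c+1`) abuts the label `r`: the `r`
in column `c` lies weakly above `x`, and either the row of `r` ends in column
`c` (`α r = c`) or the `r` in column `c+1` lies strictly below `x`. -/
def AbutsVac (D : Diagram) (α : ℕ → ℕ) (L : Cell → ℕ) (x : Cell) (r : ℕ) : Prop :=
  x ∉ D ∧ 2 ≤ x.1 ∧
  (∃ p ∈ D, p.1 + 1 = x.1 ∧ L p = r ∧ x.2 ≤ p.2) ∧
  (α r + 1 = x.1 ∨ ∃ q ∈ D, q.1 = x.1 ∧ L q = r ∧ q.2 < x.2)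

/-- `T` has a pinned semi-proper labeling `L` of some shape `α' ⪯⁰ β` in which
the vacant position `x` abuts the label `r ≤ k`. -/
def HasAbut (k : ℕ) (β : ℕ → ℕ) (T : Diagram) (x : Cell) (r : ℕ)
    (α : ℕ → ℕ) (L : Cell → ℕ) : Prop :=
  SemiProper T α L ∧ IsPinned T L ∧ PinnedSwapLE α β ∧
  1 ≤ r ∧ r ≤ k ∧ AbutsVac T α L x r

/-- Restricted rectification `Rect k β T x U y`: rectifying the pinned diagram
`T` (of pinned shape `β`) with vacant position `x`, restricted by `k`, yields
the diagram `U` with landing cell `y`.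
(1) if some pinned semi-proper labeling of shape `α' ⪯⁰ β` has `x` abutting the
rightmost `r ≤ k` (i.e. `α' r = x.1 − 1`), the cell lands;
(2) else if `x` abuts some `r ≤ k`, the lowest cell `y` of the column of `x`
carrying such a label is bumped and rectification continues from `y`;
(3) else `x` passes to the rightmost vacant position strictly to its left in
its row. -/
inductive Rect (k : ℕ) (β : ℕ → ℕ) : Diagram → Cell → Diagram → Cell → Prop
  | land (T : Diagram) (x : Cell) (α : ℕ → ℕ) (L : Cell → ℕ) (r : ℕ)
      (h : HasAbut k β T x r α L) (hend : α r + 1 = x.1) :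
      Rect k β T x (insert x T) x
  | bump (T : Diagram) (x : Cell) (α : ℕ → ℕ) (L : Cell → ℕ) (r : ℕ) (y : Cell)
      (h : HasAbut k β T x r α L)
      (hnoland : ¬ ∃ α' L' r', HasAbut k β T x r' α' L' ∧ α' r' + 1 = x.1)
      (hy : y ∈ T) (hyc : y.1 = x.1) (hyl : L y = r)
      (hlow : ∀ (α' : ℕ → ℕ) (L' : Cell → ℕ) (r' : ℕ) (y' : Cell),
        HasAbut k β T x r' α' L' → y' ∈ T → y'.1 = x.1 → L' y' = r' → y.2 ≤ y'.2)
      (U : Diagram) (z : Cell)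
      (hrec : Rect k β (insert x (T.erase y)) y U z) :
      Rect k β T x U z
  | pass (T : Diagram) (x : Cell)
      (hno : ¬ ∃ α L r, HasAbut k β T x r α L)
      (y : Cell) (hy : y ∉ T) (hrow : y.2 = x.2) (hcol : y.1 < x.1)
      (hpos : 1 ≤ y.1)
      (hfill : ∀ c', y.1 < c' → c' < x.1 → (c', x.2) ∈ T)
      (U : Diagram) (z : Cell) (hrec : Rect k β T y U z) :
      Rect k β T x U z

/-- `ThreadWeight T w`: the greedy thread decomposition of `T` has all threads
ending in column 1 (so `T` is rectified), and `w r` is the number of cells of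
the thread whose column-1 cell lies in row `r` (and `0` if there is none). -/
def ThreadWeight (T : Diagram) (w : ℕ → ℕ) : Prop :=
  ∃ ts : List (List Cell), ThreadSpec T ts ∧
    (∀ t ∈ ts, ∃ l : Cell, t.getLast? = some l ∧ l.1 = 1) ∧
    (∀ r : ℕ, 1 ≤ r →
      ((∃ t ∈ ts, t.getLast? = some ((1, r) : Cell) ∧ w r = t.length) ∨
       ((∀ t ∈ ts, t.getLast? ≠ some ((1, r) : Cell)) ∧ w r = 0))) ∧
    w 0 = 0

/-- `α` is the maximal composition with `θ(T) ⪯⁰ α ⪯ β`. -/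
def MaxRectLabel (T : Diagram) (β α : ℕ → ℕ) : Prop :=
  ∃ w : ℕ → ℕ, ThreadWeight T w ∧ PinnedSwapLE w α ∧ LSwapLE α β ∧
    ∀ α' : ℕ → ℕ, PinnedSwapLE w α' → LSwapLE α' β → LSwapLE α' α

/-- Restricted insertion `T ←_{β,k} r`: rectify the vacant position
`(max β + 1, r)` restricted by `k`, relabeling `T` by the maximal `α` with
`θ(T) ⪯⁰ α ⪯ β`; `U` is the resulting diagram and `y` the landing cell. -/
def InsertRel (k : ℕ) (β : ℕ → ℕ) (T : Diagram) (r : ℕ) (U : Diagram)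
    (y : Cell) : Prop :=
  ∃ (c : ℕ) (α : ℕ → ℕ), ((∀ i, β i ≤ c) ∧ ∃ i, β i = c) ∧
    MaxRectLabel T β α ∧ Rect k α T (c + 1, r) U y

/-- A proper labeling: a semi-proper labeling that is minimal, i.e. if `r < s`
appear in a column with `r` above `s`, then there is an `r` in the column
immediately to the right of and strictly above the `s`. -/
def ProperLab (D : Diagram) (α : ℕ → ℕ) (L : Cell → ℕ) : Prop :=
  SemiProper D α L ∧
  ∀ p ∈ D, ∀ q ∈ D, p.1 = q.1 → L p < L q → q.2 < p.2 →
    ∃ u ∈ D, u.1 = p.1 + 1 ∧ L u = L p ∧ q.2 < u.2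

/-- `(c, r)` is a `k`-addable position for the 1-indexed weak composition `β`. -/
def KAddableN (k : ℕ) (β : ℕ → ℕ) (c r : ℕ) : Prop :=
  1 ≤ r ∧ r ≤ k ∧ 1 ≤ c ∧ β r < c ∧
  (β r < c - 1 → ∃ t, k < t ∧ β t = c - 1) ∧
  (∀ s, r < s → s ≤ k → (β s < β r ∨ c ≤ β s))

/-- `γ = β +⁽ᵏ⁾ (c, r)`, the `k`-addition of the position `(c, r)` to `β`,
defined through the sequence `r = ρ 0 < ρ 1 < ⋯ < ρ q` with
`β (ρ 0) < ⋯ < β (ρ q) = c − 1` and the gap condition. -/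
def KAddN (k : ℕ) (β : ℕ → ℕ) (c r : ℕ) (γ : ℕ → ℕ) : Prop :=
  ∃ (q : ℕ) (ρ : Fin (q+1) → ℕ),
    ρ 0 = r ∧ StrictMono ρ ∧ StrictMono (fun i => β (ρ i)) ∧
    β (ρ (Fin.last q)) = c - 1 ∧
    (∀ i : Fin q, ∀ s : ℕ, ρ i.castSucc < s → s < ρ i.succ →
      β s ≤ β (ρ i.castSucc) ∨ β (ρ i.succ) < β s) ∧
    γ = fun i =>
      β (((List.ofFn fun j : Fin q => Equiv.swap r (ρ j.succ)).prod) i) +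
        (if i = r then 1 else 0)

/-- `β` is the rectified labeling after an insertion with landing column `c`:
`β = α +⁽ᵏ⁾ (c, s')` for the minimal row `s'` with `θ(U) ⪯ α +⁽ᵏ⁾ (c, s')`. -/
def RectifiedLabel (k : ℕ) (α : ℕ → ℕ) (c : ℕ) (U : Diagram) (β : ℕ → ℕ) : Prop :=
  ∃ (w : ℕ → ℕ) (s' : ℕ), ThreadWeight U w ∧
    KAddableN k α c s' ∧ KAddN k α c s' β ∧ LSwapLE w β ∧
    ∀ (s'' : ℕ) (β'' : ℕ → ℕ), KAddableN k α c s'' → KAddN k α c s'' β'' →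
      LSwapLE w β'' → s' ≤ s''

/-- The number of labels `r ∈ [1, R]` with `h ≤ p r`. -/
def cnt (p : ℕ → ℕ) (R h : ℕ) : ℕ := ((Finset.Icc 1 R).filter (fun r => h ≤ p r)).card

/-- The number of elements of `C` in `[h, h')`. -/
def seg (C : Finset ℕ) (h h' : ℕ) : ℕ := (C.filter (fun g => h ≤ g ∧ g < h')).card

/-- The number of elements of `C` that are at least `h`. -/
def upc (C : Finset ℕ) (h : ℕ) : ℕ := (C.filter (fun g => h ≤ g)).card

/-- `p` places labels bijectively on the rows in `C`; the row `0` means absent. -/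
structure IsWord (C : Finset ℕ) (p : ℕ → ℕ) : Prop where
  zero : p 0 = 0
  mem : ∀ h, h ∈ C ↔ 1 ≤ h ∧ ∃ r, p r = h
  inj : ∀ r r', p r = p r' → p r ≠ 0 → r = r'

lemma cnt_anti (p : ℕ → ℕ) (R : ℕ) {h h' : ℕ} (hh : h ≤ h') : cnt p R h' ≤ cnt p R h := by
  unfold cnt
  apply Finset.card_le_card
  intro r
  simp only [Finset.mem_filter]
  rintro ⟨a, b⟩
  exact ⟨a, hh.trans b⟩

lemma cnt_mono_word {p q : ℕ → ℕ} (hpq : ∀ r, 1 ≤ r → q r ≤ p r) (R h : ℕ) :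
    cnt q R h ≤ cnt p R h := by
  unfold cnt
  apply Finset.card_le_card
  intro r
  simp only [Finset.mem_filter, Finset.mem_Icc]
  rintro ⟨a, b⟩
  exact ⟨a, b.trans (hpq r a.1)⟩

lemma cnt_congr {p q : ℕ → ℕ} {R h h' : ℕ} (H : ∀ r, 1 ≤ r → r ≤ R → (h ≤ p r ↔ h' ≤ q r)) :
    cnt p R h = cnt q R h' := by
  unfold cnt
  congr 1
  apply Finset.filter_congr
  intro r hr
  simp only [Finset.mem_Icc] at hr
  exact H r hr.1 hr.2

lemma cnt_zero (p : ℕ → ℕ) (h : ℕ) : cnt p 0 h = 0 := by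
  simp [cnt]

lemma cnt_succ (p : ℕ → ℕ) (R h : ℕ) :
    cnt p (R + 1) h = cnt p R h + if h ≤ p (R + 1) then 1 else 0 := by
  unfold cnt
  rw [← Finset.insert_Icc_right_eq_Icc_add_one (by omega), Finset.filter_insert]
  split_ifs with hc
  · rw [Finset.card_insert_of_notMem (by simp)]
  · simp

lemma cnt_mono_R (p : ℕ → ℕ) {R R' : ℕ} (hR : R ≤ R') (h : ℕ) : cnt p R h ≤ cnt p R' h := by
  induction R', hR using Nat.le_induction with
  | base => exact le_rfl
  | succ n _ ih => rw [cnt_succ]; omega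

lemma cnt_update (p : ℕ → ℕ) (r v R h : ℕ) (hr : 1 ≤ r) :
    cnt (Function.update p r v) R h + (if r ≤ R ∧ h ≤ p r then 1 else 0) =
      cnt p R h + if r ≤ R ∧ h ≤ v then 1 else 0 := by
  induction R with
  | zero =>
    simp only [cnt_zero]
    rw [if_neg (by omega), if_neg (by omega)]
  | succ R ih =>
    rw [cnt_succ, cnt_succ]
    by_cases hrR : r = R + 1
    · subst hrR
      rw [if_neg (by omega), if_neg (by omega)] at ih
      simp only [Function.update_self, le_refl, true_and]
      omega
    · rw [Function.update_of_ne (by omega)]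
      have h1 : (r ≤ R + 1 ↔ r ≤ R) := by omega
      simp only [h1]
      omega

lemma swap_eq_update (p : ℕ → ℕ) (r s : ℕ) :
    (fun l => p (Equiv.swap r s l)) = Function.update (Function.update p r (p s)) s (p r) := by
  funext l
  by_cases h1 : l = s
  · subst h1; simp
  · rw [Function.update_of_ne h1]
    by_cases h2 : l = r
    · subst h2; simp
    · rw [Function.update_of_ne h2, Equiv.swap_apply_of_ne_of_ne h2 h1]

lemma cnt_swap (p : ℕ → ℕ) (r s R h : ℕ) (hr : 1 ≤ r) (hrs : r < s) :
    cnt (fun l => p (Equiv.swap r s l)) R h + (if r ≤ R ∧ R < s ∧ h ≤ p r then 1 else 0) =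
      cnt p R h + if r ≤ R ∧ R < s ∧ h ≤ p s then 1 else 0 := by
  rw [swap_eq_update]
  have h1 := cnt_update (Function.update p r (p s)) s (p r) R h (by omega)
  have h2 := cnt_update p r (p s) R h hr
  rw [Function.update_of_ne (by omega)] at h1
  split_ifs at * <;> omega

lemma seg_self (C : Finset ℕ) (h : ℕ) : seg C h h = 0 := by
  unfold seg
  rw [Finset.card_eq_zero, Finset.filter_eq_empty_iff]
  intro x _
  omega

lemma seg_add (C : Finset ℕ) {a b c : ℕ} (hab : a ≤ b) (hbc : b ≤ c) :
    seg C a c = seg C a b + seg C b c := by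
  unfold seg
  rw [← Finset.card_union_of_disjoint]
  · congr 1
    ext x
    simp only [Finset.mem_filter, Finset.mem_union]
    constructor
    · rintro ⟨h1, h2, h3⟩
      rcases lt_or_ge x b with h | h
      · left; exact ⟨h1, h2, h⟩
      · right; exact ⟨h1, h, h3⟩
    · rintro (⟨h1, h2, h3⟩ | ⟨h1, h2, h3⟩)
      · exact ⟨h1, h2, by omega⟩
      · exact ⟨h1, by omega, h3⟩
  · rw [Finset.disjoint_left]
    intro x
    simp only [Finset.mem_filter]
    rintro ⟨_, h2⟩ ⟨_, h3⟩
    omega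

lemma seg_one (C : Finset ℕ) (h : ℕ) : seg C h (h + 1) = if h ∈ C then 1 else 0 := by
  unfold seg
  have : (C.filter (fun g => h ≤ g ∧ g < h + 1)) = if h ∈ C then {h} else ∅ := by
    ext x
    split_ifs with hc
    · simp only [Finset.mem_filter, Finset.mem_singleton]
      constructor
      · rintro ⟨_, _, _⟩; omega
      · rintro rfl; exact ⟨hc, by omega⟩
    · simp only [Finset.mem_filter, Finset.notMem_empty, iff_false]
      rintro ⟨hx, _, _⟩
      have : x = h := by omega
      exact hc (this ▸ hx)
  rw [this]
  split_ifs <;> simp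

lemma seg_congr {C C' : Finset ℕ} {h h' : ℕ} (H : ∀ g, h ≤ g → g < h' → (g ∈ C ↔ g ∈ C')) :
    seg C h h' = seg C' h h' := by
  unfold seg
  congr 1
  ext g
  simp only [Finset.mem_filter]
  constructor
  · rintro ⟨a, b, c⟩; exact ⟨(H g b c).1 a, b, c⟩
  · rintro ⟨a, b, c⟩; exact ⟨(H g b c).2 a, b, c⟩

lemma seg_insert {C : Finset ℕ} {a h h' : ℕ} (ha : a ∉ C) :
    seg (insert a C) h h' = seg C h h' + if h ≤ a ∧ a < h' then 1 else 0 := by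
  unfold seg
  rw [Finset.filter_insert]
  split_ifs
  · rw [Finset.card_insert_of_notMem (by simp [ha])]
  · simp

lemma upc_insert {C : Finset ℕ} {a h : ℕ} (ha : a ∉ C) :
    upc (insert a C) h = upc C h + if h ≤ a then 1 else 0 := by
  unfold upc
  rw [Finset.filter_insert]
  split_ifs
  · rw [Finset.card_insert_of_notMem (by simp [ha])]
  · simp

/-- Every word has bounded support. -/
lemma IsWord.bound {C : Finset ℕ} {p : ℕ → ℕ} (hp : IsWord C p) : ∃ Z, ∀ r, Z ≤ r → p r = 0 := by
  have hfin : {r | p r ≠ 0}.Finite := by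
    apply Set.Finite.of_finite_image (f := p)
    · apply C.finite_toSet.subset
      rintro _ ⟨r, hr, rfl⟩
      exact (hp.mem _).2 ⟨Nat.one_le_iff_ne_zero.2 hr, r, rfl⟩
    · intro a ha b _ hab
      exact hp.inj a b hab ha
  obtain ⟨Z, hZ⟩ := hfin.bddAbove
  refine ⟨Z + 1, fun r hr => ?_⟩
  by_contra hne
  have := hZ hne
  omega

lemma IsWord.pos_of {C : Finset ℕ} {p : ℕ → ℕ} (hp : IsWord C p) {r : ℕ} (h : p r ≠ 0) :
    1 ≤ r := by
  rcases Nat.eq_zero_or_pos r with rfl | h'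
  · exact absurd hp.zero h
  · exact h'

lemma IsWord.cnt_le_upc {C : Finset ℕ} {p : ℕ → ℕ} (hp : IsWord C p) (R : ℕ) {h : ℕ} (hh : 1 ≤ h) :
    cnt p R h ≤ upc C h := by
  unfold cnt upc
  apply Finset.card_le_card_of_injOn p
  · intro r hr
    simp only [Finset.coe_filter, Set.mem_ofPred_eq] at hr ⊢
    exact ⟨(hp.mem _).2 ⟨by omega, r, rfl⟩, hr.2⟩
  · intro r hr r' _ e
    simp only [Finset.coe_filter, Set.mem_ofPred_eq] at hr
    exact hp.inj r r' e (by omega)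

lemma IsWord.cnt_eq_upc {C : Finset ℕ} {p : ℕ → ℕ} (hp : IsWord C p) {Z R : ℕ}
    (hZ : ∀ r, Z ≤ r → p r = 0) (hR : Z ≤ R + 1) {h : ℕ} (hh : 1 ≤ h) :
    cnt p R h = upc C h := by
  apply le_antisymm (hp.cnt_le_upc R hh)
  unfold cnt upc
  have : (C.filter (fun g => h ≤ g)) ⊆ ((Finset.Icc 1 R).filter (fun r => h ≤ p r)).image p := by
    intro g hg
    simp only [Finset.mem_filter, Finset.mem_image, Finset.mem_Icc] at hg ⊢
    obtain ⟨_, r, rfl⟩ := (hp.mem g).1 hg.1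
    refine ⟨r, ⟨⟨hp.pos_of (by omega), ?_⟩, hg.2⟩, rfl⟩
    by_contra hc
    have := hZ r (by omega)
    omega
  exact (Finset.card_le_card this).trans Finset.card_image_le

/-- One step of the counting function of a word. -/
lemma IsWord.cnt_step {C : Finset ℕ} {p : ℕ → ℕ} (hp : IsWord C p) (R : ℕ) {r : ℕ}
    (hr : p r ≠ 0) : cnt p R (p r) = cnt p R (p r + 1) + if r ≤ R then 1 else 0 := by
  have h1 := cnt_update p r 0 R (p r) (hp.pos_of hr)
  have h2 := cnt_update p r 0 R (p r + 1) (hp.pos_of hr)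
  have h3 : cnt (Function.update p r 0) R (p r) = cnt (Function.update p r 0) R (p r + 1) := by
    apply cnt_congr
    intro r' _ _
    by_cases e : r' = r
    · subst e; simp; omega
    · rw [Function.update_of_ne e]
      have : p r' ≠ p r := fun e' => e (hp.inj r r' e'.symm hr).symm
      omega
  split_ifs at * <;> omega

lemma cnt_step_of_ne {p : ℕ → ℕ} {h : ℕ} (R : ℕ) (hh : ∀ r, p r ≠ h) :
    cnt p R h = cnt p R (h + 1) := by
  apply cnt_congr
  intro r' _ _
  have := hh r'
  omega

lemma IsWord.cnt_step_notMem {C : Finset ℕ} {p : ℕ → ℕ} (hp : IsWord C p) (R : ℕ) {h : ℕ}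
    (hh : 1 ≤ h) (hC : h ∉ C) : cnt p R h = cnt p R (h + 1) := by
  apply cnt_step_of_ne
  intro r e
  exact hC ((hp.mem h).2 ⟨hh, r, e⟩)

lemma IsWord.cnt_step_le {C : Finset ℕ} {p : ℕ → ℕ} (hp : IsWord C p) (R : ℕ) {h : ℕ}
    (hh : 1 ≤ h) : cnt p R h ≤ cnt p R (h + 1) + if h ∈ C then 1 else 0 := by
  by_cases hC : h ∈ C
  · obtain ⟨_, r, rfl⟩ := (hp.mem h).1 hC
    rw [hp.cnt_step R (by omega), if_pos hC]
    split_ifs <;> omega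
  · rw [hp.cnt_step_notMem R hh hC]; omega

lemma IsWord.cnt_seg {C : Finset ℕ} {p : ℕ → ℕ} (hp : IsWord C p) (R : ℕ) {h h' : ℕ}
    (hh : 1 ≤ h) (hh' : h ≤ h') : cnt p R h ≤ cnt p R h' + seg C h h' := by
  induction h', hh' using Nat.le_induction with
  | base => omega
  | succ n hn ih =>
    have h1 := hp.cnt_step_le R (h := n) (by omega)
    rw [seg_add C hn (by omega : n ≤ n + 1), seg_one]
    omega

lemma IsWord.empty : IsWord ∅ (fun _ => 0) :=
  ⟨rfl, fun h => by simp; omega, fun _ _ _ h => absurd rfl h⟩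

lemma IsWord.insert {C : Finset ℕ} {q : ℕ → ℕ} (hq : IsWord C q) {a r : ℕ} (ha : a ∉ C)
    (ha1 : 1 ≤ a) (hr : q r = 0) (hr1 : 1 ≤ r) :
    IsWord (insert a C) (Function.update q r a) := by
  refine ⟨?_, ?_, ?_⟩
  · rw [Function.update_of_ne (by omega)]; exact hq.zero
  · intro h
    rw [Finset.mem_insert, hq.mem]
    constructor
    · rintro (rfl | ⟨h1, r', h2⟩)
      · exact ⟨ha1, r, by simp⟩
      · refine ⟨h1, r', ?_⟩
        rw [Function.update_of_ne]
        · exact h2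
        · rintro rfl; omega
    · rintro ⟨h1, r', h2⟩
      by_cases e : r' = r
      · subst e; left; simpa using h2.symm
      · rw [Function.update_of_ne e] at h2
        exact Or.inr ⟨h1, r', h2⟩
  · intro r1 r2 h1 h2
    have hna : ∀ r', q r' ≠ a := fun r' e => ha ((hq.mem a).2 ⟨ha1, r', e⟩)
    by_cases e1 : r1 = r <;> by_cases e2 : r2 = r
    · rw [e1, e2]
    · subst e1
      rw [Function.update_of_ne e2, Function.update_self] at h1
      exact absurd h1.symm (hna r2)
    · subst e2
      rw [Function.update_of_ne e1, Function.update_self] at h1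
      exact absurd h1 (hna r1)
    · rw [Function.update_of_ne e1] at h1 h2
      rw [Function.update_of_ne e2] at h1
      exact hq.inj r1 r2 h1 h2

/-- Greedy labeling of a column from the word of the previous column. -/
lemma exists_greedy {P C : Finset ℕ} {p : ℕ → ℕ} (hp : IsWord P p) (h0 : 0 ∉ C)
    (hC : ∀ h, 1 ≤ h → upc C h ≤ upc P h) :
    ∃ q, IsWord C q ∧ (∀ r, q r ≤ p r) ∧
      ∀ R h, 1 ≤ h → ∃ h', h ≤ h' ∧ cnt p R h' + seg C h h' ≤ cnt q R h := by
  induction C using Finset.induction_on_min with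
  | empty =>
    refine ⟨fun _ => 0, IsWord.empty, fun r => Nat.zero_le _, fun R h hh => ?_⟩
    obtain ⟨B, hB⟩ := P.bddAbove
    refine ⟨max h (B + 1), le_max_left _ _, ?_⟩
    have := hp.cnt_le_upc R (h := max h (B + 1)) (by omega)
    have h2 : upc P (max h (B + 1)) = 0 := by
      unfold upc
      rw [Finset.card_eq_zero, Finset.filter_eq_empty_iff]
      intro x hx
      have := hB hx
      omega
    have h3 : seg ∅ h (max h (B + 1)) = 0 := by simp [seg]
    omega
  | insert a C ha ih =>
    have haC : a ∉ C := fun h => lt_irrefl _ (ha a h)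
    have ha1 : 1 ≤ a := by
      rcases Nat.eq_zero_or_pos a with rfl | h
      · simp at h0
      · exact h
    obtain ⟨q, hq, hqp, hg⟩ := ih (by simp at h0; exact h0.2) (fun h hh =>
      le_trans (by rw [upc_insert haC]; omega) (hC h hh))
    have hqa : ∀ r, q r ≠ 0 → a < q r := fun r hr =>
      ha _ ((hq.mem _).2 ⟨by omega, r, rfl⟩)
    obtain ⟨Z, hZ⟩ := hp.bound
    have hex : ∃ r, a ≤ p r ∧ q r = 0 := by
      by_contra hcon
      push Not at hcon
      have h1 := hC a ha1
      rw [upc_insert haC, if_pos le_rfl, ← hp.cnt_eq_upc (R := Z) hZ (by omega) ha1] at h1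
      have h2 := hq.cnt_le_upc Z ha1
      have h3 : cnt p Z a ≤ cnt q Z a := by
        unfold cnt
        apply Finset.card_le_card
        intro r
        simp only [Finset.mem_filter]
        rintro ⟨u, v⟩
        exact ⟨u, (hqa r (hcon r v)).le⟩
      omega
    classical
    obtain ⟨r, ⟨hra, hr0⟩, hmin⟩ : ∃ r, (a ≤ p r ∧ q r = 0) ∧
        ∀ r' < r, ¬ (a ≤ p r' ∧ q r' = 0) :=
      ⟨Nat.find hex, Nat.find_spec hex, fun r' h => Nat.find_min hex h⟩
    have hr1 : 1 ≤ r := hp.pos_of (r := r) (by omega)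
    refine ⟨Function.update q r a, hq.insert haC ha1 hr0 hr1, ?_, ?_⟩
    · intro r'
      by_cases e : r' = r
      · subst e; simpa using hra
      · rw [Function.update_of_ne e]; exact hqp r'
    · intro R h hh
      have hu := cnt_update q r a R h hr1
      rw [hr0] at hu
      by_cases hc : h ≤ a ∧ R < r
      · refine ⟨a, hc.1, ?_⟩
        have h1 : seg (Insert.insert a C) h a = 0 := by
          unfold seg
          rw [Finset.card_eq_zero, Finset.filter_eq_empty_iff]
          intro x hx
          rcases Finset.mem_insert.1 hx with rfl | hx
          · omega
          · have := ha x hx; omega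
        have h2 : cnt p R a ≤ cnt q R h := by
          unfold cnt
          apply Finset.card_le_card
          intro r'
          simp only [Finset.mem_filter, Finset.mem_Icc]
          rintro ⟨u, v⟩
          refine ⟨u, ?_⟩
          have h3 := hmin r' (by omega)
          have h4 := hqa r' (fun e => h3 ⟨v, e⟩)
          omega
        split_ifs at hu <;> omega
      · obtain ⟨h', hh', hle⟩ := hg R h hh
        refine ⟨h', hh', ?_⟩
        rw [seg_insert haC]
        split_ifs at * <;> omega

/-- The pointwise largest counting function of column `m` for the threshold `R`. -/
noncomputable def upper (C : ℕ → Finset ℕ) (R : ℕ) : ℕ → ℕ → ℕ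
  | 0, h => R + 1 - h
  | m + 1, h => sInf {x | ∃ h', h ≤ h' ∧ x = upper C R m h' + seg (C (m + 1)) h h'}

/-- Auxiliary recursion for `lower`, with the number of remaining columns as first argument. -/
def lowerAux (N : ℕ → ℕ) (C : ℕ → Finset ℕ) : ℕ → ℕ → ℕ → ℕ
  | 0, _, _ => 0
  | _ + 1, m, 0 => N m
  | n + 1, m, h + 1 => max (lowerAux N C n (m + 1) (h + 1))
      (lowerAux N C (n + 1) m h - if h ∈ C m then 1 else 0)

/-- The pointwise smallest counting function of column `m`, given the prescribed totals `N` in all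
columns, which vanish from column `W` on. -/
def lower (W : ℕ) (N : ℕ → ℕ) (C : ℕ → Finset ℕ) (m h : ℕ) : ℕ := lowerAux N C (W - m) m h

lemma upper_le (C : ℕ → Finset ℕ) (R m : ℕ) {h h' : ℕ} (hh : h ≤ h') :
    upper C R (m + 1) h ≤ upper C R m h' + seg (C (m + 1)) h h' :=
  Nat.sInf_le ⟨h', hh, rfl⟩

lemma upper_mem (C : ℕ → Finset ℕ) (R m h : ℕ) :
    ∃ h', h ≤ h' ∧ upper C R (m + 1) h = upper C R m h' + seg (C (m + 1)) h h' :=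
  Nat.sInf_mem (s := {x | ∃ h', h ≤ h' ∧ x = upper C R m h' + seg (C (m + 1)) h h'})
    ⟨_, h, le_rfl, rfl⟩

lemma upper_col (C : ℕ → Finset ℕ) (R m h : ℕ) : upper C R (m + 1) h ≤ upper C R m h := by
  have := upper_le C R m (le_refl h)
  rwa [seg_self] at this

lemma upper_seg (C : ℕ → Finset ℕ) (R : ℕ) {m h h' : ℕ} (hm : 1 ≤ m) (hh : h ≤ h') :
    upper C R m h ≤ upper C R m h' + seg (C m) h h' := by
  obtain ⟨m, rfl⟩ : ∃ n, m = n + 1 := ⟨m - 1, by omega⟩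
  obtain ⟨g, hg, e⟩ := upper_mem C R m h'
  rw [e]
  have := upper_le C R m (hh.trans hg)
  rw [seg_add _ hh hg] at this
  omega

lemma upper_rec (C : ℕ → Finset ℕ) (R m h : ℕ) :
    upper C R m h ≤ upper C R (m + 1) h ∨
      upper C R (m + 1) (h + 1) + (if h ∈ C (m + 1) then 1 else 0) ≤ upper C R (m + 1) h := by
  obtain ⟨g, hg, e⟩ := upper_mem C R m h
  rcases hg.eq_or_lt with rfl | hlt
  · left; rw [e]; omega
  · right
    have := upper_le C R m (h := h + 1) (h' := g) hlt
    rw [e, seg_add _ (by omega : h ≤ h + 1) hlt, seg_one]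
    omega

lemma upper_anti (C : ℕ → Finset ℕ) (R m : ℕ) {h h' : ℕ} (hh : h ≤ h') :
    upper C R m h' ≤ upper C R m h := by
  induction m generalizing h h' with
  | zero => simp only [upper]; omega
  | succ m ih =>
    obtain ⟨g, hg, e⟩ := upper_mem C R m h
    rw [e]
    rcases le_total h' g with hc | hc
    · have := upper_le C R m hc
      rw [seg_add _ hh hc]
      omega
    · have := upper_col C R m h'
      have := ih hc
      omega

lemma upper_congr {C C' : ℕ → Finset ℕ} (R : ℕ) {m h : ℕ}
    (H : ∀ n, 1 ≤ n → n ≤ m → ∀ g, h ≤ g → (g ∈ C n ↔ g ∈ C' n)) :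
    upper C R m h = upper C' R m h := by
  induction m generalizing h with
  | zero => rfl
  | succ m ih =>
    have key : ∀ h', h ≤ h' → upper C R m h' + seg (C (m + 1)) h h' =
        upper C' R m h' + seg (C' (m + 1)) h h' := by
      intro h' hh
      rw [ih (fun n h1 h2 g hg => H n h1 (by omega) g (by omega)),
        seg_congr (fun g hg _ => H (m + 1) (by omega) le_rfl g hg)]
    have : {x | ∃ h', h ≤ h' ∧ x = upper C R m h' + seg (C (m + 1)) h h'} =
        {x | ∃ h', h ≤ h' ∧ x = upper C' R m h' + seg (C' (m + 1)) h h'} := by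
      ext x
      constructor
      · rintro ⟨h', hh, rfl⟩; exact ⟨h', hh, key h' hh⟩
      · rintro ⟨h', hh, rfl⟩; exact ⟨h', hh, (key h' hh).symm⟩
    simp only [upper, this]

lemma upper_empty (C : ℕ → Finset ℕ) (R : ℕ) {m : ℕ} (h : ℕ) (hm : 1 ≤ m) (he : C m = ∅) :
    upper C R m h = 0 := by
  have h0 : ∀ n, upper C R n (max h (R + 1)) = 0 := by
    intro n
    induction n with
    | zero => simp only [upper]; omega
    | succ n ih => have := upper_col C R n (max h (R + 1)); omega
  have h1 := upper_seg C R hm (le_max_left h (R + 1))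
  rw [h0, he] at h1
  have : seg ∅ h (max h (R + 1)) = 0 := by simp [seg]
  omega

lemma lower_of_le {W m : ℕ} (N : ℕ → ℕ) (C : ℕ → Finset ℕ) (h : ℕ) (hm : W ≤ m) :
    lower W N C m h = 0 := by
  unfold lower
  rw [Nat.sub_eq_zero_of_le hm, lowerAux]

lemma lower_zero {W : ℕ} {N : ℕ → ℕ} (C : ℕ → Finset ℕ) (hN : ∀ m, W ≤ m → N m = 0) (m : ℕ) :
    lower W N C m 0 = N m := by
  rcases le_or_gt W m with h | h
  · rw [lower_of_le _ _ _ h, hN m h]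
  · unfold lower
    obtain ⟨n, hn⟩ : ∃ n, W - m = n + 1 := ⟨W - m - 1, by omega⟩
    rw [hn, lowerAux]

lemma lower_succ (W : ℕ) (N : ℕ → ℕ) (C : ℕ → Finset ℕ) (m h : ℕ) :
    lower W N C m (h + 1) = max (lower W N C (m + 1) (h + 1))
      (lower W N C m h - if h ∈ C m then 1 else 0) := by
  rcases le_or_gt W m with hm | hm
  · simp [lower_of_le N C _ hm, lower_of_le N C _ (by omega : W ≤ m + 1)]
  · unfold lower
    obtain ⟨n, hn⟩ : ∃ n, W - m = n + 1 := ⟨W - m - 1, by omega⟩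
    have hn' : W - (m + 1) = n := by omega
    rw [hn, hn', lowerAux]

/-- Induction on the columns from right to left. -/
lemma rightToLeft {P : ℕ → Prop} (W : ℕ) (hW : ∀ m, W ≤ m → P m) (hs : ∀ m, P (m + 1) → P m)
    (m : ℕ) : P m := by
  have key : ∀ n m, W ≤ m + n → P m := by
    intro n
    induction n with
    | zero => exact fun m h => hW m h
    | succ n ih => exact fun m h => hs m (ih (m + 1) (by omega))
  exact key W m (by omega)

lemma lower_step (W : ℕ) (N : ℕ → ℕ) (C : ℕ → Finset ℕ) (m h : ℕ) :
    lower W N C m h ≤ lower W N C m (h + 1) + if h ∈ C m then 1 else 0 := by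
  rw [lower_succ]
  omega

lemma lower_seg (W : ℕ) (N : ℕ → ℕ) (C : ℕ → Finset ℕ) (m : ℕ) {h h' : ℕ} (hh : h ≤ h') :
    lower W N C m h ≤ lower W N C m h' + seg (C m) h h' := by
  induction h', hh using Nat.le_induction with
  | base => omega
  | succ n hn ih =>
    have h1 := lower_step W N C m n
    rw [seg_add _ hn (by omega : n ≤ n + 1), seg_one]
    omega

lemma lower_col {W : ℕ} {N : ℕ → ℕ} (C : ℕ → Finset ℕ) (hN : ∀ m, W ≤ m → N m = 0)
    (hanti : ∀ m, N (m + 1) ≤ N m) (m h : ℕ) : lower W N C (m + 1) h ≤ lower W N C m h := by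
  cases h with
  | zero => rw [lower_zero C hN, lower_zero C hN]; exact hanti m
  | succ h => rw [lower_succ W N C m]; omega

lemma lower_anti {W : ℕ} {N : ℕ → ℕ} (C : ℕ → Finset ℕ) (hN : ∀ m, W ≤ m → N m = 0)
    (hanti : ∀ m, N (m + 1) ≤ N m) (m : ℕ) {h h' : ℕ} (hh : h ≤ h') :
    lower W N C m h' ≤ lower W N C m h := by
  have key : ∀ m, ∀ h, lower W N C m (h + 1) ≤ lower W N C m h := by
    refine fun m => rightToLeft (P := fun m => ∀ h, lower W N C m (h + 1) ≤ lower W N C m h) W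
      ?_ ?_ m
    · intro m hm h
      rw [lower_of_le N C _ hm]
      omega
    · intro m ih h
      rw [lower_succ]
      have h1 := ih h
      have h2 := lower_col C hN hanti m h
      omega
  induction h', hh using Nat.le_induction with
  | base => omega
  | succ n hn ih => have := key m n; omega

lemma lower_congr {W : ℕ} {N N' : ℕ → ℕ} {C C' : ℕ → Finset ℕ} (hN : ∀ m, W ≤ m → N m = 0)
    (hN' : ∀ m, W ≤ m → N' m = 0) {m h : ℕ} (hNN : ∀ n, m ≤ n → N n = N' n)
    (H : ∀ n, m ≤ n → ∀ g, g < h → (g ∈ C n ↔ g ∈ C' n)) :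
    lower W N C m h = lower W N' C' m h := by
  have key : ∀ n, m ≤ n → ∀ g, g ≤ h → lower W N C n g = lower W N' C' n g := by
    refine fun n => rightToLeft
      (P := fun n => m ≤ n → ∀ g, g ≤ h → lower W N C n g = lower W N' C' n g) W ?_ ?_ n
    · intro n hn _ g _
      rw [lower_of_le _ _ _ hn, lower_of_le _ _ _ hn]
    · intro n ih hmn g hg
      induction g with
      | zero => rw [lower_zero C hN, lower_zero C' hN', hNN n hmn]
      | succ g ihg =>
        rw [lower_succ W N C n, lower_succ W N' C' n, ih (by omega) _ hg, ihg (by omega)]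
        have := H n hmn g (by omega)
        simp only [this]
  exact key m le_rfl h le_rfl

lemma lower_mono {W : ℕ} {N N' : ℕ → ℕ} (C : ℕ → Finset ℕ) (hN : ∀ m, W ≤ m → N m = 0)
    (hN' : ∀ m, W ≤ m → N' m = 0) {m : ℕ} (h : ℕ) (hNN : ∀ n, m ≤ n → N n ≤ N' n) :
    lower W N C m h ≤ lower W N' C m h := by
  have key : ∀ n, m ≤ n → ∀ g, lower W N C n g ≤ lower W N' C n g := by
    refine fun n => rightToLeft
      (P := fun n => m ≤ n → ∀ g, lower W N C n g ≤ lower W N' C n g) W ?_ ?_ n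
    · intro n hn _ g
      rw [lower_of_le _ _ _ hn, lower_of_le _ _ _ hn]
    · intro n ih hmn g
      induction g with
      | zero => rw [lower_zero C hN, lower_zero C hN']; exact hNN n hmn
      | succ g ihg =>
        rw [lower_succ W N C n, lower_succ W N' C n]
        have := ih (by omega) (g + 1)
        omega
  exact key m le_rfl h

lemma lower_diff {W : ℕ} {N N' : ℕ → ℕ} (C : ℕ → Finset ℕ) (hN : ∀ m, W ≤ m → N m = 0)
    (hN' : ∀ m, W ≤ m → N' m = 0) (hd : ∀ m, N (m + 1) + N' m ≤ N m + N' (m + 1))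
    (hle : ∀ m, N' m ≤ N m) (m : ℕ) :
    ∀ h, lower W N' C m h ≤ lower W N C m h ∧
      lower W N C (m + 1) h + lower W N' C m h ≤ lower W N C m h + lower W N' C (m + 1) h ∧
      lower W N C m (h + 1) + lower W N' C m h ≤ lower W N C m h + lower W N' C m (h + 1) := by
  refine rightToLeft (P := fun m => ∀ h, lower W N' C m h ≤ lower W N C m h ∧
      lower W N C (m + 1) h + lower W N' C m h ≤ lower W N C m h + lower W N' C (m + 1) h ∧
      lower W N C m (h + 1) + lower W N' C m h ≤ lower W N C m h + lower W N' C m (h + 1)) W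
      ?_ ?_ m
  · intro n hn g
    simp [lower_of_le _ _ _ hn, lower_of_le _ _ _ (by omega : W ≤ n + 1)]
  · intro n ih h
    have step : ∀ h, lower W N C (n + 1) h + lower W N' C n h ≤
        lower W N C n h + lower W N' C (n + 1) h → lower W N' C n h ≤ lower W N C n h →
        lower W N C n (h + 1) + lower W N' C n h ≤ lower W N C n h + lower W N' C n (h + 1) ∧
        lower W N C (n + 1) (h + 1) + lower W N' C n (h + 1) ≤
          lower W N C n (h + 1) + lower W N' C (n + 1) (h + 1) := by
      intro h h1 h2
      rw [lower_succ W N C n, lower_succ W N' C n]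
      obtain ⟨_, _, h3⟩ := ih h
      obtain ⟨h4, _, _⟩ := ih (h + 1)
      generalize (if h ∈ C n then 1 else 0) = e
      omega
    have base : lower W N' C n h ≤ lower W N C n h ∧ lower W N C (n + 1) h + lower W N' C n h ≤
        lower W N C n h + lower W N' C (n + 1) h := by
      induction h with
      | zero =>
        simp only [lower_zero C hN, lower_zero C hN']
        exact ⟨hle n, hd n⟩
      | succ h ihh =>
        have h1 := (step h ihh.2 ihh.1).2
        obtain ⟨h4, _, _⟩ := ih (h + 1)
        exact ⟨by omega, h1⟩
    exact ⟨base.1, base.2, (step h base.2 base.1).1⟩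

/-- The first `n` columns of a pinned family of words on the columns `C`, with label counts bounded
below by those of `β`. -/
structure Fam (C : ℕ → Finset ℕ) (β : ℕ → ℕ) (n : ℕ) (pos : ℕ → ℕ → ℕ) : Prop where
  pin : ∀ r, pos 1 r = 0 ∨ pos 1 r = r
  word : ∀ m, 1 ≤ m → m ≤ n → IsWord (C m) (pos m)
  dom : ∀ m, 1 ≤ m → m < n → ∀ r, pos (m + 1) r ≤ pos m r
  lab : ∀ m, 1 ≤ m → m ≤ n → ∀ R, cnt β R m ≤ cnt (pos m) R 1

/-- The columns `C` admit a pinned family of words of some shape below `β`. -/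
structure Good (C : ℕ → Finset ℕ) (β : ℕ → ℕ) : Prop where
  fam : ∃ pos, ∀ n, Fam C β n pos
  total : ∃ Z, ∀ R, Z ≤ R → ∀ m, 1 ≤ m → cnt β R m = (C m).card
  first : ∀ r, 1 ≤ r → (0 < β r ↔ r ∈ C 1)

/-- `lower` for the totals of the composition `β` restricted to labels `≤ R`. -/
def low (W : ℕ) (β : ℕ → ℕ) (C : ℕ → Finset ℕ) (R m h : ℕ) : ℕ :=
  lower W (fun m => cnt β R m) C m h

lemma cnt_eq_zero {β : ℕ → ℕ} {W : ℕ} (hW : ∀ r, 1 ≤ r → β r < W) (R : ℕ) {m : ℕ} (hm : W ≤ m) :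
    cnt β R m = 0 := by
  unfold cnt
  rw [Finset.card_eq_zero, Finset.filter_eq_empty_iff]
  intro r hr
  have := hW r (Finset.mem_Icc.1 hr).1
  omega

lemma Fam.of_le {C : ℕ → Finset ℕ} {β : ℕ → ℕ} {n m : ℕ} {pos : ℕ → ℕ → ℕ} (hF : Fam C β n pos)
    (h : m ≤ n) : Fam C β m pos :=
  ⟨hF.pin, fun k h1 h2 => hF.word k h1 (by omega), fun k h1 h2 => hF.dom k h1 (by omega),
    fun k h1 h2 => hF.lab k h1 (by omega)⟩

lemma Fam.congr {C : ℕ → Finset ℕ} {β : ℕ → ℕ} {n : ℕ} {pos pos' : ℕ → ℕ → ℕ} (hF : Fam C β n pos)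
    (hn : 1 ≤ n) (h : ∀ m, m ≤ n → pos' m = pos m) : Fam C β n pos' := by
  refine ⟨?_, ?_, ?_, ?_⟩
  · rw [h 1 hn]; exact hF.pin
  · intro m h1 h2; rw [h m h2]; exact hF.word m h1 h2
  · intro m h1 h2; rw [h m (by omega), h (m + 1) h2]; exact hF.dom m h1 h2
  · intro m h1 h2; rw [h m h2]; exact hF.lab m h1 h2

lemma Fam.extend {C : ℕ → Finset ℕ} {β : ℕ → ℕ} {n : ℕ} {pos : ℕ → ℕ → ℕ} (hF : Fam C β n pos)
    (hn : 1 ≤ n) {q : ℕ → ℕ} (hq : IsWord (C (n + 1)) q) (hqp : ∀ r, q r ≤ pos n r)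
    (hlab : ∀ R, cnt β R (n + 1) ≤ cnt q R 1) :
    Fam C β (n + 1) (Function.update pos (n + 1) q) := by
  have hu : ∀ m, m ≤ n → Function.update pos (n + 1) q m = pos m := fun m hm =>
    Function.update_of_ne (by omega) _ _
  refine ⟨?_, ?_, ?_, ?_⟩
  · rw [hu 1 hn]; exact hF.pin
  · intro m h1 h2
    rcases Nat.lt_or_ge n m with hm | hm
    · obtain rfl : m = n + 1 := by omega
      simpa using hq
    · rw [hu m hm]; exact hF.word m h1 hm
  · intro m h1 h2
    rw [hu m (by omega)]
    rcases Nat.lt_or_ge n (m + 1) with hm | hm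
    · obtain rfl : m = n := by omega
      simpa using hqp
    · rw [hu _ hm]; exact hF.dom m h1 hm
  · intro m h1 h2
    rcases Nat.lt_or_ge n m with hm | hm
    · obtain rfl : m = n + 1 := by omega
      simpa using hlab
    · rw [hu m hm]; exact hF.lab m h1 hm

lemma IsWord.swap {C : Finset ℕ} {p : ℕ → ℕ} (hp : IsWord C p) {r s : ℕ} (hr : 1 ≤ r)
    (hs : 1 ≤ s) : IsWord C (fun l => p (Equiv.swap r s l)) := by
  refine ⟨?_, ?_, ?_⟩
  · rw [Equiv.swap_apply_of_ne_of_ne (by omega) (by omega)]; exact hp.zero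
  · intro h
    rw [hp.mem]
    constructor
    · rintro ⟨h1, l, hl⟩
      exact ⟨h1, Equiv.swap r s l, by simpa using hl⟩
    · rintro ⟨h1, l, hl⟩
      exact ⟨h1, _, hl⟩
  · intro l l' h1 h2
    exact (Equiv.swap r s).injective (hp.inj _ _ h1 h2)

lemma cnt_swap_one (p : ℕ → ℕ) {r s : ℕ} (hr : 1 ≤ r) (hrs : r < s) (hpr : 0 < p r) (hps : 0 < p s)
    (R : ℕ) : cnt (fun l => p (Equiv.swap r s l)) R 1 = cnt p R 1 := by
  have := cnt_swap p r s R 1 hr hrs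
  split_ifs at this <;> omega

/-- Two labels of a column of a family may be exchanged so that the smaller label moves down. -/
lemma Fam.reach_swap {C : ℕ → Finset ℕ} {β : ℕ → ℕ} {n : ℕ} (hn : 1 ≤ n) {pos : ℕ → ℕ → ℕ}
    (hF : Fam C β n pos) {r s : ℕ} (hr : 1 ≤ r) (hrs : r < s) (hlt : pos n s < pos n r)
    (hpos : 0 < pos n s) :
    ∃ pos', Fam C β n pos' ∧ ∀ l, pos' n l = pos n (Equiv.swap r s l) := by
  induction n, hn using Nat.le_induction with
  | base =>
    have h1 := hF.pin r
    have h2 := hF.pin s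
    omega
  | succ n hn ih =>
    have hFn := hF.of_le (Nat.le_succ n)
    have hq := hF.word (n + 1) (by omega) le_rfl
    have hd := hF.dom n hn (by omega)
    have main : ∀ pos', Fam C β n pos' →
        (∀ l, pos (n + 1) (Equiv.swap r s l) ≤ pos' n l) →
        ∃ pos', Fam C β (n + 1) pos' ∧ ∀ l, pos' (n + 1) l = pos (n + 1) (Equiv.swap r s l) := by
      intro pos' hF' hle
      refine ⟨_, hF'.extend hn (hq.swap hr (by omega)) hle ?_, ?_⟩
      · intro R
        rw [cnt_swap_one _ hr hrs (by omega) hpos]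
        exact hF.lab (n + 1) (by omega) le_rfl R
      · intro l; simp
    rcases le_or_gt (pos (n + 1) r) (pos n s) with hc | hc
    · apply main pos hFn
      intro l
      by_cases h1 : l = r
      · subst h1
        rw [Equiv.swap_apply_left]
        have := hd l; omega
      · by_cases h2 : l = s
        · subst h2; rw [Equiv.swap_apply_right]; exact hc
        · rw [Equiv.swap_apply_of_ne_of_ne h1 h2]; exact hd l
    · have hr' := hd r
      have hs' := hd s
      obtain ⟨pos', hF', he⟩ := ih hFn (by omega) (by omega)
      exact main pos' hF' (fun l => by rw [he]; exact hd _)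

lemma Fam.cnt_le_upper {C : ℕ → Finset ℕ} {β : ℕ → ℕ} {n : ℕ} (hn : 1 ≤ n) {pos : ℕ → ℕ → ℕ}
    (hF : Fam C β n pos) (R : ℕ) {h : ℕ} (hh : 1 ≤ h) : cnt (pos n) R h ≤ upper C R n h := by
  induction n, hn using Nat.le_induction generalizing h with
  | base =>
    obtain ⟨h', hh', e⟩ := upper_mem C R 0 h
    rw [zero_add] at e
    rw [e]
    have h1 := (hF.word 1 le_rfl le_rfl).cnt_seg R hh hh'
    have h2 : cnt (pos 1) R h' ≤ R + 1 - h' := by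
      unfold cnt
      calc _ ≤ (Finset.Icc h' R).card := by
            apply Finset.card_le_card
            intro r
            simp only [Finset.mem_filter, Finset.mem_Icc]
            rintro ⟨⟨a, b⟩, c⟩
            have := hF.pin r
            omega
        _ = _ := by simp
    simp only [upper]
    omega
  | succ n hn ih =>
    obtain ⟨h', hh', e⟩ := upper_mem C R n h
    rw [e]
    have h1 := (hF.word (n + 1) (by omega) le_rfl).cnt_seg R hh hh'
    have h2 := ih (hF.of_le (Nat.le_succ n)) (h := h') (by omega)
    have h3 := cnt_mono_word (p := pos n) (q := pos (n + 1))
      (fun r _ => hF.dom n hn (by omega) r) R h'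
    omega

lemma cntN_zero {β : ℕ → ℕ} {W : ℕ} (hW : ∀ r, 1 ≤ r → β r < W) (R : ℕ) :
    ∀ m, W ≤ m → (fun m => cnt β R m) m = 0 := fun _ hm => cnt_eq_zero hW R hm

lemma cntN_anti (β : ℕ → ℕ) (R : ℕ) : ∀ m, (fun m => cnt β R m) (m + 1) ≤ (fun m => cnt β R m) m :=
  fun m => cnt_anti β R (Nat.le_succ m)

lemma low_le_cnt {C : ℕ → Finset ℕ} {β : ℕ → ℕ} {pos : ℕ → ℕ → ℕ} (hF : ∀ n, Fam C β n pos) {W : ℕ}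
    (hW : ∀ r, 1 ≤ r → β r < W) (R : ℕ) {m : ℕ} (hm : 1 ≤ m) (h : ℕ) :
    low W β C R m h ≤ cnt (pos m) R h := by
  revert hm h
  refine rightToLeft (P := fun m => 1 ≤ m → ∀ h, low W β C R m h ≤ cnt (pos m) R h) W ?_ ?_ m
  · intro m hm _ h
    unfold low
    rw [lower_of_le _ _ _ hm]; omega
  · intro m ih hm h
    have hlab := (hF m).lab m hm le_rfl R
    have hword := (hF m).word m hm le_rfl
    have hz : low W β C R m 0 ≤ cnt (pos m) R 1 := by
      unfold low; rw [lower_zero C (cntN_zero hW R)]; exact hlab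
    induction h with
    | zero => exact hz.trans (cnt_anti _ _ (by omega))
    | succ h ihh =>
      unfold low at *
      rw [lower_succ]
      have h1 := ih (by omega) (h + 1)
      have h2 := cnt_mono_word (p := pos m) (q := pos (m + 1))
        (fun r _ => (hF (m + 1)).dom m hm (by omega) r) R (h + 1)
      have h3 : lower W (fun m => cnt β R m) C m h - (if h ∈ C m then 1 else 0) ≤
          cnt (pos m) R (h + 1) := by
        rcases Nat.eq_zero_or_pos h with rfl | hpos
        · exact (Nat.sub_le _ _).trans hz
        · have := hword.cnt_step_le R hpos
          omega
      omega

lemma Good.upc_col {C : ℕ → Finset ℕ} {β : ℕ → ℕ} (hG : Good C β) {m : ℕ} (hm : 1 ≤ m) {h : ℕ}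
    (hh : 1 ≤ h) : upc (C (m + 1)) h ≤ upc (C m) h := by
  obtain ⟨pos, hF⟩ := hG.fam
  have w1 := (hF m).word m hm le_rfl
  have w2 := (hF (m + 1)).word (m + 1) (by omega) le_rfl
  obtain ⟨Z, hZ⟩ := w1.bound
  have hd := (hF (m + 1)).dom m hm (by omega)
  rw [← w1.cnt_eq_upc (R := Z) hZ (by omega) hh, ← w2.cnt_eq_upc (R := Z)
    (fun r hr => by have := hd r; have := hZ r hr; omega) (by omega) hh]
  exact cnt_mono_word (fun r _ => hd r) Z h

lemma Good.zero_notMem {C : ℕ → Finset ℕ} {β : ℕ → ℕ} (hG : Good C β) {m : ℕ} (hm : 1 ≤ m) :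
    0 ∉ C m := by
  obtain ⟨pos, hF⟩ := hG.fam
  intro h
  have := ((hF m).word m hm le_rfl).mem 0
  have := (this.1 h).1
  omega

lemma Good.empty {C : ℕ → Finset ℕ} {β : ℕ → ℕ} (hG : Good C β) {W : ℕ}
    (hW : ∀ r, 1 ≤ r → β r < W) {m : ℕ} (hm : 1 ≤ m) (hWm : W ≤ m) : C m = ∅ := by
  obtain ⟨Z, hZ⟩ := hG.total
  have := hZ Z le_rfl m hm
  rw [cnt_eq_zero hW Z hWm] at this
  exact Finset.card_eq_zero.1 this.symm

/-- In the `upper` labeling the counting function of every column is as large as possible. -/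
lemma Good.exists_upper {C : ℕ → Finset ℕ} {β : ℕ → ℕ} (hG : Good C β) {n : ℕ} (hn : 1 ≤ n) :
    ∃ pos, Fam C β n pos ∧ ∀ R h, 1 ≤ h → upper C R n h ≤ cnt (pos n) R h := by
  obtain ⟨pos₀, hF₀⟩ := hG.fam
  induction n, hn using Nat.le_induction with
  | base =>
    refine ⟨pos₀, hF₀ 1, fun R h hh => ?_⟩
    have h1 := upper_le C R 0 (le_max_left h (R + 1))
    have h2 : upper C R 0 (max h (R + 1)) = 0 := by simp only [upper]; omega
    have h3 : seg (C 1) h (max h (R + 1)) ≤ cnt (pos₀ 1) R h := by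
      unfold seg cnt
      apply Finset.card_le_card
      intro g
      simp only [Finset.mem_filter, Finset.mem_Icc]
      rintro ⟨a, b, c⟩
      obtain ⟨d, r, e⟩ := (((hF₀ 1).word 1 le_rfl le_rfl).mem g).1 a
      have hr := (hF₀ 1).pin r
      obtain rfl : r = g := by omega
      exact ⟨by omega, by omega⟩
    rw [zero_add] at h1
    omega
  | succ n hn ih =>
    obtain ⟨pos, hF, hup⟩ := ih
    obtain ⟨q, hq, hqp, hg⟩ := exists_greedy (hF.word n hn le_rfl) (hG.zero_notMem (m := n + 1)
      (by omega)) (fun h hh => hG.upc_col hn hh)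
    have key : ∀ R h, 1 ≤ h → upper C R (n + 1) h ≤ cnt q R h := by
      intro R h hh
      obtain ⟨h', hh', hle⟩ := hg R h hh
      have h1 := upper_le C R n hh'
      have h2 := hup R h' (by omega)
      omega
    refine ⟨_, hF.extend hn hq hqp ?_, ?_⟩
    · intro R
      exact ((hF₀ (n + 1)).lab (n + 1) (by omega) le_rfl R).trans
        (((hF₀ (n + 1)).cnt_le_upper (by omega) R le_rfl).trans (key R 1 le_rfl))
    · simpa using key

/-- Extending a family to the right. -/
lemma Good.extend_right {C : ℕ → Finset ℕ} {β : ℕ → ℕ} (hG : Good C β) {W : ℕ}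
    (hW : ∀ r, 1 ≤ r → β r < W) {n : ℕ} (hn : 1 ≤ n) {pos : ℕ → ℕ → ℕ} (hF : Fam C β n pos)
    (hlow : ∀ R h, 1 ≤ h → low W β C R n h ≤ cnt (pos n) R h) :
    ∃ pos', (∀ m, Fam C β m pos') ∧ ∀ m, m ≤ n → pos' m = pos m := by
  have step : ∀ j, ∃ pos', Fam C β (n + j) pos' ∧ (∀ m, m ≤ n → pos' m = pos m) ∧
      ∀ R h, 1 ≤ h → low W β C R (n + j) h ≤ cnt (pos' (n + j)) R h := by
    intro j
    induction j with
    | zero => exact ⟨pos, hF, fun _ _ => rfl, hlow⟩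
    | succ j ih =>
      obtain ⟨pos', hF', hag, hl⟩ := ih
      obtain ⟨q, hq, hqp, hg⟩ := exists_greedy (hF'.word (n + j) (by omega) le_rfl)
        (hG.zero_notMem (m := n + j + 1) (by omega)) (fun h hh => hG.upc_col (by omega) hh)
      have key : ∀ R h, 1 ≤ h → low W β C R (n + j + 1) h ≤ cnt q R h := by
        intro R h hh
        obtain ⟨h', hh', hle⟩ := hg R h hh
        have h1 := hl R h' (by omega)
        have h2 := lower_col C (cntN_zero hW R) (cntN_anti β R) (n + j) h'
        have h3 := lower_seg W (fun m => cnt β R m) C (n + j + 1) hh'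
        unfold low at *
        omega
      refine ⟨_, hF'.extend (by omega) hq hqp ?_, ?_, ?_⟩
      · intro R
        have h1 := key R 1 le_rfl
        have h2 := lower_step W (fun m => cnt β R m) C (n + j + 1) 0
        rw [if_neg (hG.zero_notMem (by omega)), lower_zero C (cntN_zero hW R)] at h2
        unfold low at h1
        rw [zero_add] at h2
        omega
      · intro m hm
        rw [Function.update_of_ne (by omega)]
        exact hag m hm
      · simpa [← add_assoc] using key
  obtain ⟨pos', hF', hag, -⟩ := step W
  have hag' : ∀ m, m ≤ n + W → (fun m => if m ≤ n + W then pos' m else fun _ => 0) m = pos' m :=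
    fun m hm => by simp [hm]
  have hF'' := hF'.congr (by omega) hag'
  refine ⟨fun m => if m ≤ n + W then pos' m else fun _ => 0, fun m => ?_, fun m hm => ?_⟩
  · refine ⟨hF''.pin, ?_, ?_, ?_⟩
    · intro k h1 h2
      by_cases hk : k ≤ n + W
      · exact hF''.word k h1 hk
      · simp only [hk, if_false]
        rw [hG.empty hW h1 (by omega)]
        exact IsWord.empty
    · intro k h1 h2 r
      by_cases hk : k + 1 ≤ n + W
      · exact hF''.dom k h1 hk r
      · simp only [hk, if_false]; omega
    · intro k h1 h2 R
      by_cases hk : k ≤ n + W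
      · exact hF''.lab k h1 hk R
      · rw [cnt_eq_zero hW R (by omega)]; omega
  · rw [hag' m (by omega), hag m hm]

/-- A word `w` on the column `C ∪ {a}` whose counting functions dominate `v` (strictly, on `(b, a]`
and for thresholds `≥ k`), and none of whose inversions may be removed. -/
structure TightWord (C : Finset ℕ) (a b k : ℕ) (v : ℕ → ℕ → ℕ) (w : ℕ → ℕ) : Prop where
  apos : 1 ≤ a
  lt : b < a
  notMem : a ∉ C
  word : IsWord (insert a C) w
  step : ∀ R h, v R h ≤ v R (h + 1) + if h ∈ C then 1 else 0
  mono : ∀ R R' h, R' ≤ R → v R' h ≤ v R h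
  diff : ∀ R R' h h', R' ≤ R → h ≤ h' → v R h' + v R' h ≤ v R h + v R' h'
  ge : ∀ R h, 1 ≤ h → v R h + (if k ≤ R ∧ b < h ∧ h ≤ a then 1 else 0) ≤ cnt w R h
  tight : ∀ r s, 1 ≤ r → r < s → w s < w r → 0 < w s →
    ∃ R h, r ≤ R ∧ R < s ∧ w s < h ∧ h ≤ w r ∧
      cnt w R h ≤ v R h + if k ≤ R ∧ b < h ∧ h ≤ a then 1 else 0

namespace TightWord

variable {C : Finset ℕ} {a b k : ℕ} {v : ℕ → ℕ → ℕ} {w : ℕ → ℕ}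

lemma cnt_diff {p : ℕ → ℕ} {R R' h h' : ℕ} (hR : R' ≤ R) (hh : h ≤ h')
    (H : ∀ r, R' < r → r ≤ R → h ≤ p r → h' ≤ p r) :
    cnt p R h' + cnt p R' h = cnt p R h + cnt p R' h' := by
  induction R, hR using Nat.le_induction with
  | base => omega
  | succ R hR ih =>
    have h1 := ih (fun r h1 h2 => H r h1 (by omega))
    have h2 := H (R + 1) (by omega) le_rfl
    rw [cnt_succ, cnt_succ]
    split_ifs <;> omega

lemma no_large (t : TightWord C a b k v w) {g i j : ℕ} (hbg : b < g) (hga : g ≤ a) (hi : w i = g)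
    (hik : k < i) (hex : ∃ R, j ≤ R ∧ R < k ∧ cnt w R g ≤ v R g)
    (hup : ∀ R, j ≤ R → R < k → ∀ h, g < h → h ≤ a → v R h + 1 ≤ cnt w R h) : False := by
  obtain ⟨R₁, ⟨hj, hRk, hR₁⟩, hmax⟩ : ∃ R, (j ≤ R ∧ R < k ∧ cnt w R g ≤ v R g) ∧
      ∀ R', R < R' → ¬ (j ≤ R' ∧ R' < k ∧ cnt w R' g ≤ v R' g) := by
    classical
    obtain ⟨R, hR⟩ := hex
    refine ⟨Nat.findGreatest (fun R => j ≤ R ∧ R < k ∧ cnt w R g ≤ v R g) k,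
      Nat.findGreatest_spec (P := fun R => j ≤ R ∧ R < k ∧ cnt w R g ≤ v R g) hR.2.1.le hR,
      fun R' hR' hc => ?_⟩
    have := Nat.le_findGreatest (P := fun R => j ≤ R ∧ R < k ∧ cnt w R g ≤ v R g) hc.2.1.le hc
    omega
  have hgt : ∀ R, R₁ < R → v R g + 1 ≤ cnt w R g := by
    intro R hR
    by_cases hk : R < k
    · have := hmax R hR
      push Not at this
      exact this (by omega) hk
    · have := t.ge R g (by omega)
      rw [if_pos ⟨by omega, hbg, hga⟩] at this
      exact this
  -- the lowest row above `g` whose label lies in `(R₁, i)`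
  have hexp : ∃ p r, w r = p ∧ g < p ∧ R₁ < r ∧ r < i := by
    by_contra hcon
    push Not at hcon
    have h1 := hgt k hRk
    have h2 : cnt w k g = cnt w R₁ g := by
      have : ∀ R, R₁ ≤ R → R ≤ k → cnt w R g = cnt w R₁ g := by
        intro R hR
        induction R, hR using Nat.le_induction with
        | base => intro _; rfl
        | succ R hR ih =>
          intro hRk
          rw [cnt_succ, if_neg, ih (by omega)]
          · rfl
          · intro hle
            rcases hle.eq_or_lt with e | hlt
            · have := t.word.inj i (R + 1) (hi.trans e) (by omega)
              omega
            · have := hcon _ (R + 1) rfl hlt (by omega)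
              omega
      exact this k hRk.le le_rfl
    have h3 := t.mono k R₁ g hRk.le
    omega
  classical
  obtain ⟨p, ⟨r, hrp, hgp, hRr, hri⟩, hpmin⟩ :
      ∃ p, (∃ r, w r = p ∧ g < p ∧ R₁ < r ∧ r < i) ∧
        ∀ p' < p, ¬ ∃ r, w r = p' ∧ g < p' ∧ R₁ < r ∧ r < i :=
    ⟨Nat.find hexp, Nat.find_spec hexp, fun p' h => Nat.find_min hexp h⟩
  obtain ⟨R, h, h1, h2, h3, h4, h5⟩ := t.tight r i (by omega) hri (by omega) (by omega)
  rw [hi] at h3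
  rw [hrp] at h4
  have e := cnt_diff (p := w) (R := R) (R' := R₁) (h := g) (h' := h) (by omega) h3.le (by
    intro r' hr1 hr2 hr3
    by_contra hlt
    rcases hr3.eq_or_lt with e | hlt'
    · have := t.word.inj i r' (hi.trans e) (by omega)
      omega
    · exact hpmin (w r') (by omega) ⟨r', rfl, hlt', hr1, by omega⟩)
  have e2 := t.diff R R₁ g h (by omega) h3.le
  have e3 := hgt R (by omega)
  have e4 := t.ge R₁ h (by omega)
  by_cases hha : h ≤ a
  · have e5 := hup R₁ hj hRk h h3 hha
    split_ifs at * <;> omega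
  · rw [if_neg (by omega)] at h5
    omega

lemma label_le (t : TightWord C a b k v w) {j : ℕ} (hj : w j = a) : j ≤ k := by
  by_contra hc
  refine t.no_large (j := 0) t.lt le_rfl hj (by omega) ⟨0, le_rfl, ?_, ?_⟩ (by omega)
  · by_contra hk
    have := t.ge 0 a t.apos
    rw [cnt_zero, if_pos ⟨by omega, t.lt, le_rfl⟩] at this
    omega
  · rw [cnt_zero]; omega

lemma gap_descend (t : TightWord C a b k v w) {R h : ℕ} (hh : 1 ≤ h) (hle : cnt w R h ≤ v R h)
    (hs : v R (h + 1) + 1 ≤ cnt w R (h + 1)) : h ∈ C ∧ ∃ i, R < i ∧ w i = h := by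
  have h1 := t.step R h
  have h2 := cnt_anti w R (Nat.le_succ h)
  have hC : h ∈ C := by
    by_contra hC
    rw [if_neg hC] at h1
    simp only [Nat.succ_eq_add_one] at h2
    omega
  obtain ⟨_, i, hi⟩ := (t.word.mem h).1 (Finset.mem_insert_of_mem hC)
  refine ⟨hC, i, ?_, hi⟩
  by_contra hc
  have := t.word.cnt_step R (r := i) (by omega)
  rw [hi, if_pos (by omega)] at this
  rw [if_pos hC] at h1
  omega

lemma gap_upper (t : TightWord C a b k v w) {j : ℕ} (hj : w j = a) {R : ℕ} (hR : j ≤ R) {h : ℕ}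
    (hb : b < h) (ha : h ≤ a) : v R h + 1 ≤ cnt w R h := by
  have key : ∀ n h, h + n = a → b < h → ∀ R, j ≤ R → v R h + 1 ≤ cnt w R h := by
    intro n
    induction n using Nat.strong_induction_on with
    | _ n ih =>
      intro h hn hb R hR
      have h0 := t.apos
      rcases Nat.eq_zero_or_pos n with rfl | hn0
      · obtain rfl : h = a := by omega
        have h1 := t.word.cnt_step R (r := j) (by omega)
        rw [hj, if_pos hR] at h1
        have h2 := t.step R h
        rw [if_neg t.notMem] at h2
        have h3 := t.ge R (h + 1) (by omega)
        omega
      · by_contra hcon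
        have hup : ∀ R, j ≤ R → ∀ h', h < h' → h' ≤ a → v R h' + 1 ≤ cnt w R h' :=
          fun R hR h' h1 h2 => ih (a - h') (by omega) h' (by omega) (by omega) R hR
        have hRk : R < k := by
          by_contra hk
          have := t.ge R h (by omega)
          rw [if_pos ⟨by omega, hb, by omega⟩] at this
          omega
        obtain ⟨hC, i, hRi, hi⟩ := t.gap_descend (R := R) (h := h) (by omega) (by omega)
          (hup R hR (h + 1) (by omega) (by omega))
        by_cases hik : k < i
        · exact t.no_large hb (by omega) hi hik ⟨R, hR, hRk, by omega⟩
            (fun R hR _ => hup R hR)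
        · have hj1 : 1 ≤ j := t.word.pos_of (by omega)
          obtain ⟨R2, h2, a1, a2, a3, a4, a5⟩ := t.tight j i hj1 (by omega) (by omega) (by omega)
          have := hup R2 a1 h2 (by omega) (by omega)
          rw [if_neg (by omega)] at a5
          omega
  exact key (a - h) h (by omega) hb R hR

lemma gap_lower (t : TightWord C a b k v w) (hb1 : 1 ≤ b) {R₀ : ℕ} (hk : k ≤ R₀)
    (hR₀ : cnt w R₀ b ≤ v R₀ b) : b ∈ C ∧ ∃ i, R₀ < i ∧ w i = b ∧
      ∀ R, i ≤ R → ∀ h, 1 ≤ h → h ≤ b → v R h + 1 ≤ cnt w R h := by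
  have hlt := t.lt
  have hge : ∀ R, k ≤ R → v R (b + 1) + 1 ≤ cnt w R (b + 1) := by
    intro R hR
    have := t.ge R (b + 1) (by omega)
    rw [if_pos ⟨hR, by omega, hlt⟩] at this
    exact this
  obtain ⟨hC, i, hi, hwi⟩ := t.gap_descend hb1 hR₀ (hge R₀ hk)
  refine ⟨hC, i, hi, hwi, ?_⟩
  have key : ∀ n h, h + n = b → 1 ≤ h → ∀ R, i ≤ R → v R h + 1 ≤ cnt w R h := by
    intro n
    induction n using Nat.strong_induction_on with
    | _ n ih =>
      intro h hn hb R hR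
      rcases Nat.eq_zero_or_pos n with rfl | hn0
      · obtain rfl : h = b := by omega
        have h1 := t.word.cnt_step R (r := i) (by omega)
        rw [hwi, if_pos hR] at h1
        have h2 := t.step R h
        rw [if_pos hC] at h2
        have h3 := hge R (by omega)
        omega
      · by_contra hcon
        have hup : ∀ R, i ≤ R → ∀ h', h < h' → h' ≤ b → v R h' + 1 ≤ cnt w R h' :=
          fun R hR h' h1 h2 => ih (b - h') (by omega) h' (by omega) (by omega) R hR
        obtain ⟨hC', i', hRi, hi'⟩ := t.gap_descend (R := R) (h := h) (by omega) (by omega)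
          (hup R hR (h + 1) (by omega) (by omega))
        have hi1 : 1 ≤ i := t.word.pos_of (by omega)
        obtain ⟨R2, h2, a1, a2, a3, a4, a5⟩ := t.tight i i' hi1 (by omega) (by omega) (by omega)
        have := hup R2 a1 h2 (by omega) (by omega)
        rw [if_neg (by omega)] at a5
        omega
  exact fun R hR h h1 h2 => key (b - h) h (by omega) h1 R hR

end TightWord

lemma IsWord.erase {E : Finset ℕ} {w : ℕ → ℕ} (hw : IsWord E w) {j : ℕ} (hj : w j ≠ 0) :
    IsWord (E.erase (w j)) (Function.update w j 0) := by
  have hj1 := hw.pos_of hj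
  refine ⟨?_, ?_, ?_⟩
  · rw [Function.update_of_ne (by omega)]; exact hw.zero
  · intro h
    rw [Finset.mem_erase, hw.mem]
    constructor
    · rintro ⟨h1, h2, r, h3⟩
      refine ⟨h2, r, ?_⟩
      rw [Function.update_of_ne]
      · exact h3
      · rintro rfl; exact h1 h3.symm
    · rintro ⟨h1, r, h2⟩
      by_cases e : r = j
      · subst e
        rw [Function.update_self] at h2
        omega
      · rw [Function.update_of_ne e] at h2
        exact ⟨fun e' => e (hw.inj r j (h2.trans e') (by omega)), h1, r, h2⟩
  · intro r r' h1 h2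
    by_cases e : r = j
    · subst e; rw [Function.update_self] at h2; exact absurd rfl h2
    · rw [Function.update_of_ne e] at h1 h2
      by_cases e' : r' = j
      · subst e'; rw [Function.update_self] at h1; exact absurd h1 h2
      · rw [Function.update_of_ne e'] at h1
        exact hw.inj r r' h1 h2

lemma seg_add_upc (C : Finset ℕ) (h : ℕ) : seg C 0 h + upc C h = C.card := by
  unfold seg upc
  rw [← Finset.card_union_of_disjoint]
  · congr 1
    ext x
    simp only [Finset.mem_filter, Finset.mem_union]
    constructor
    · rintro (h | h)
      · exact h.1
      · exact h.1
    · intro hx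
      rcases lt_or_ge x h with h' | h'
      · left; exact ⟨hx, by omega, h'⟩
      · right; exact ⟨hx, h'⟩
  · rw [Finset.disjoint_left]
    intro x
    simp only [Finset.mem_filter]
    rintro ⟨_, h2⟩ ⟨_, h3⟩
    omega

/-- The gap between columns `c` and `c + 1` is positive at height `h`, for all thresholds `≥ k`. -/
def Gap (W k : ℕ) (β : ℕ → ℕ) (C : ℕ → Finset ℕ) (c h : ℕ) : Prop :=
  ∀ R, k ≤ R → low W β C R (c + 1) h + 1 ≤ upper C R c h

lemma low_diff {β : ℕ → ℕ} {C : ℕ → Finset ℕ} {W : ℕ} (hW : ∀ r, 1 ≤ r → β r < W) {R R' : ℕ}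
    (hR : R' ≤ R) (m h : ℕ) : low W β C R' m h ≤ low W β C R m h ∧
      low W β C R m (h + 1) + low W β C R' m h ≤ low W β C R m h + low W β C R' m (h + 1) := by
  have := lower_diff C (cntN_zero hW R) (cntN_zero hW R') (fun m => ?_)
    (fun m => cnt_mono_R β hR m) m h
  · exact ⟨this.1, this.2.2⟩
  · induction R, hR using Nat.le_induction with
    | base => omega
    | succ R hR ih =>
      simp only [cnt_succ] at *
      split_ifs <;> omega

lemma low_diff' {β : ℕ → ℕ} {C : ℕ → Finset ℕ} {W : ℕ} (hW : ∀ r, 1 ≤ r → β r < W) {R R' : ℕ}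
    (hR : R' ≤ R) (m : ℕ) {h h' : ℕ} (hh : h ≤ h') :
    low W β C R m h' + low W β C R' m h ≤ low W β C R m h + low W β C R' m h' := by
  induction h', hh using Nat.le_induction with
  | base => omega
  | succ n hn ih => have := (low_diff (C := C) hW hR m n).2; omega

lemma Good.low_le_upper {C : ℕ → Finset ℕ} {β : ℕ → ℕ} (hG : Good C β) {W : ℕ}
    (hW : ∀ r, 1 ≤ r → β r < W) (R : ℕ) {m h : ℕ} (hm : 1 ≤ m) (hh : 1 ≤ h) :
    low W β C R m h ≤ upper C R m h := by
  obtain ⟨pos, hF⟩ := hG.fam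
  exact (low_le_cnt hF hW R hm h).trans ((hF m).cnt_le_upper hm R hh)

/-- The candidates for the word of column `c + 1` with an additional cell in row `a`. -/
structure Candidate (C : ℕ → Finset ℕ) (β : ℕ → ℕ) (c a Z : ℕ) (V : ℕ → ℕ → ℕ) (w : ℕ → ℕ) :
    Prop where
  word : IsWord (insert a (C (c + 1))) w
  ge : ∀ R h, 1 ≤ h → V R h ≤ cnt w R h
  fam : ∃ pos, Fam C β c pos ∧ ∀ r, r ≠ Z → w r ≤ pos c r
  bound : ∀ r, Z < r → w r = 0

lemma Candidate.exists_tight {C : ℕ → Finset ℕ} {β : ℕ → ℕ} {c a Z : ℕ} {V : ℕ → ℕ → ℕ} {w₀ : ℕ → ℕ}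
    (hc : 1 ≤ c) (hw₀ : Candidate C β c a Z V w₀) :
    ∃ w, Candidate C β c a Z V w ∧ ∀ r s, 1 ≤ r → r < s → w s < w r → 0 < w s →
      ∃ R h, r ≤ R ∧ R < s ∧ w s < h ∧ h ≤ w r ∧ cnt w R h ≤ V R h := by
  obtain ⟨B, hB⟩ := (insert a (C (c + 1))).bddAbove
  let Φ : (ℕ → ℕ) → ℕ := fun w => ∑ R ∈ Finset.range (Z + 1), ∑ h ∈ Finset.range (B + 1), cnt w R h
  obtain ⟨w, hw, hmin⟩ := WellFounded.has_min (measure Φ).wf {w | Candidate C β c a Z V w}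
    ⟨w₀, hw₀⟩
  refine ⟨w, hw, ?_⟩
  intro r s hr hrs hlt hpos
  by_contra hcon
  push Not at hcon
  have hsw := fun R h => cnt_swap w r s R h hr hrs
  have hrZ : r ≤ Z := by
    by_contra hc'
    have := hw.bound r (by omega)
    omega
  have hsZ : s ≤ Z := by
    by_contra hc'
    have := hw.bound s (by omega)
    omega
  refine hmin (fun l => w (Equiv.swap r s l)) ?_ ?_
  · refine ⟨hw.word.swap hr (by omega), ?_, ?_, ?_⟩
    · intro R h hh
      have h1 := hsw R h
      have h2 := hw.ge R h hh
      by_cases hx : r ≤ R ∧ R < s ∧ w s < h ∧ h ≤ w r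
      · have h3 := hcon R h hx.1 hx.2.1 hx.2.2.1 hx.2.2.2
        split_ifs at h1 <;> omega
      · split_ifs at h1 <;> omega
    · obtain ⟨pos, hF, hle⟩ := hw.fam
      have fin : ∀ pos', Fam C β c pos' → (∀ l, l ≠ r → l ≠ s → pos' c l = pos c l) →
          w s ≤ pos' c r → (s ≠ Z → w r ≤ pos' c s) →
          ∃ pos, Fam C β c pos ∧ ∀ l, l ≠ Z → w (Equiv.swap r s l) ≤ pos c l := by
        intro pos' hF' h0 h1 h2
        refine ⟨pos', hF', fun l hl => ?_⟩
        by_cases e1 : l = r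
        · subst e1; rw [Equiv.swap_apply_left]; exact h1
        · by_cases e2 : l = s
          · subst e2; rw [Equiv.swap_apply_right]; exact h2 hl
          · rw [Equiv.swap_apply_of_ne_of_ne e1 e2, h0 l e1 e2]; exact hle l hl
      have hr' := hle r (by omega)
      by_cases hx : s ≠ Z ∧ pos c s < w r
      · have hs' := hle s hx.1
        obtain ⟨pos', hF', he⟩ := hF.reach_swap hc hr hrs (by omega) (by omega)
        refine fin pos' hF' (fun l h1 h2 => ?_) ?_ (fun _ => ?_)
        · rw [he, Equiv.swap_apply_of_ne_of_ne h1 h2]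
        · rw [he, Equiv.swap_apply_left]; exact hs'
        · rw [he, Equiv.swap_apply_right]; exact hr'
      · refine fin pos hF (fun _ _ _ => rfl) (by omega) (fun h => ?_)
        push Not at hx
        exact hx h
    · intro l hl
      rw [Equiv.swap_apply_of_ne_of_ne (by omega) (by omega)]
      exact hw.bound l hl
  · change Φ _ < Φ w
    have hle : ∀ R h, cnt (fun l => w (Equiv.swap r s l)) R h ≤ cnt w R h := by
      intro R h
      have h1 := hsw R h
      split_ifs at h1 <;> omega
    apply Finset.sum_lt_sum
    · exact fun R _ => Finset.sum_le_sum fun h _ => hle R h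
    · refine ⟨r, Finset.mem_range.2 (by omega), Finset.sum_lt_sum (fun h _ => hle r h) ?_⟩
      have hwB : w r ≤ B := hB ((hw.word.mem _).2 ⟨by omega, r, rfl⟩)
      refine ⟨w r, Finset.mem_range.2 (by omega), ?_⟩
      have h1 := hsw r (w r)
      rw [if_pos ⟨le_rfl, hrs, le_rfl⟩, if_neg (by omega)] at h1
      omega

lemma Good.exists_candidate {C : ℕ → Finset ℕ} {β : ℕ → ℕ} (hG : Good C β) {W : ℕ}
    (hW : ∀ r, 1 ≤ r → β r < W) {c a b k : ℕ} (hc : 1 ≤ c) (ha : 1 ≤ a) (haC : a ∉ C (c + 1))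
    (hgap : ∀ h, b < h → h ≤ a → Gap W k β C c h) (Z₀ : ℕ) :
    ∃ Z w, Z₀ < Z ∧ Candidate C β c a Z (fun R h => low W β C R (c + 1) h +
      if k ≤ R ∧ b < h ∧ h ≤ a then 1 else 0) w := by
  obtain ⟨pos, hF, hup⟩ := hG.exists_upper hc
  have hu := hF.word c hc le_rfl
  obtain ⟨Z₁, hZ₁⟩ := hu.bound
  obtain ⟨B, hB⟩ := (insert a (C c)).bddAbove
  have haB : a ≤ B := hB (Finset.mem_insert_self _ _)
  have hBC : ∀ x ∈ C c, x ≤ B := fun x hx => hB (Finset.mem_insert_of_mem hx)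
  have hBn : B + 1 ∉ C c := fun h => by have := hBC _ h; omega
  set Z := max Z₀ Z₁ + 1 with hZ
  have hu' : IsWord (insert (B + 1) (C c)) (Function.update (pos c) Z (B + 1)) :=
    hu.insert hBn (by omega) (hZ₁ Z (by omega)) (by omega)
  have hE0 : 0 ∉ insert a (C (c + 1)) := by
    rw [Finset.mem_insert]
    rintro (h | h)
    · omega
    · exact hG.zero_notMem (by omega) h
  obtain ⟨w, hw, hwu, hg⟩ := exists_greedy hu' hE0 (by
    intro h hh
    rw [upc_insert haC, upc_insert hBn]
    have := hG.upc_col hc hh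
    split_ifs <;> omega)
  refine ⟨Z, w, by omega, hw, ?_, ⟨pos, hF, ?_⟩, ?_⟩
  · intro R h hh
    obtain ⟨h', hh', hle⟩ := hg R h hh
    have h1 := cnt_update (pos c) Z (B + 1) R h' (by omega)
    rw [hZ₁ Z (by omega)] at h1
    have h2 := hup R h' (by omega)
    have h3 := (lower_col C (cntN_zero hW R) (cntN_anti β R) c h').trans
      (hG.low_le_upper hW R hc (by omega : 1 ≤ h'))
    have h4 := lower_seg W (fun m => cnt β R m) C (c + 1) hh'
    rw [seg_insert haC] at hle
    have h5 : k ≤ R → b < h' → h' ≤ a → low W β C R (c + 1) h' + 1 ≤ upper C R c h' :=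
      fun x y z => hgap h' y z R x
    unfold low at *
    by_cases hx : k ≤ R ∧ b < h ∧ h ≤ a
    · by_cases hy : h' ≤ a
      · have := h5 hx.1 (by omega) hy
        split_ifs at * <;> omega
      · split_ifs at * <;> omega
    · split_ifs at * <;> omega
  · intro r hr
    have := hwu r
    rwa [Function.update_of_ne hr] at this
  · intro r hr
    have := hwu r
    rw [Function.update_of_ne (by omega), hZ₁ r (by omega)] at this
    omega

/-- If the gap is positive on `(b, a]`, a position in row `a` of column `c + 1` can abut a label
`≤ k` whose cell in column `c + 1` lies in row `≤ b`. -/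
lemma Good.exists_abut {C : ℕ → Finset ℕ} {β : ℕ → ℕ} (hG : Good C β) {W : ℕ}
    (hW : ∀ r, 1 ≤ r → β r < W) {c a b k : ℕ} (hc : 1 ≤ c) (ha : 1 ≤ a) (haC : a ∉ C (c + 1))
    (hba : b < a) (hgap : ∀ h, b < h → h ≤ a → Gap W k β C c h)
    (hb : b = 0 ∨ ¬ Gap W k β C c b) :
    ∃ pos, (∀ m, Fam C β m pos) ∧ ∃ r, 1 ≤ r ∧ r ≤ k ∧ a ≤ pos c r ∧ pos (c + 1) r ≤ b := by
  obtain ⟨R₀, hR₀⟩ : ∃ R₀, k ≤ R₀ ∧ (b = 0 ∨ upper C R₀ c b ≤ low W β C R₀ (c + 1) b) := by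
    rcases hb with h | h
    · exact ⟨k, le_rfl, Or.inl h⟩
    · unfold Gap at h
      push Not at h
      obtain ⟨R, h1, h2⟩ := h
      exact ⟨R, h1, Or.inr (by omega)⟩
  obtain ⟨Zt, hZt⟩ := hG.total
  obtain ⟨Z, w₀, hZ, hw₀⟩ := hG.exists_candidate hW hc ha haC hgap (max R₀ Zt)
  obtain ⟨w, hw, htight⟩ := hw₀.exists_tight hc
  have t : TightWord (C (c + 1)) a b k (fun R h => low W β C R (c + 1) h) w :=
    ⟨ha, hba, haC, hw.word, fun R h => lower_step _ _ _ _ _,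
      fun R R' h hR => (low_diff hW hR _ _).1, fun R R' h h' hR hh => low_diff' hW hR _ hh,
      hw.ge, htight⟩
  obtain ⟨pos, hF, hwpos⟩ := hw.fam
  obtain ⟨-, j, hj⟩ := (hw.word.mem a).1 (Finset.mem_insert_self _ _)
  have hj1 : 1 ≤ j := hw.word.pos_of (by omega)
  have hjk := t.label_le hj
  have hup := fun R (hR : j ≤ R) h (h1 : b < h) (h2 : h ≤ a) => t.gap_upper hj hR h1 h2
  have hZlab : ∀ i, (b < w Z → w Z ≤ a → j ≤ Z - 1) →
      (w Z ≠ 0 → w Z ≤ b → low W β C (Z - 1) (c + 1) (w Z) + 1 ≤ cnt w (Z - 1) (w Z)) →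
      i = Z → w Z = 0 := by
    intro i H1 H2 _
    by_contra hne
    have e1 := hw.word.cnt_eq_upc (Z := Z + 1) (R := Z) (h := w Z)
      (fun r hr => hw.bound r (by omega)) le_rfl (by omega)
    rw [upc_insert haC] at e1
    have e2 := cnt_succ w (Z - 1) (w Z)
    rw [Nat.sub_add_cancel (by omega), if_pos le_rfl, e1] at e2
    have e3 := lower_seg W (fun m => cnt β (Z - 1) m) C (c + 1) (Nat.zero_le (w Z))
    rw [lower_zero C (cntN_zero hW _), hZt (Z - 1) (by omega) (c + 1) (by omega)] at e3
    have e4 := seg_add_upc (C (c + 1)) (w Z)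
    have e5 := t.ge (Z - 1) (w Z) (by omega)
    have e6 : b < w Z → w Z ≤ a → _ := fun h1 h2 => hup (Z - 1) (H1 h1 h2) (w Z) h1 h2
    have e7 := H2 hne
    unfold low at *
    split_ifs at * <;> omega
  -- it suffices to find the word of column `c + 1`
  have fin : ∀ q, IsWord (C (c + 1)) q → (∀ r, q r ≤ pos c r) → q j ≤ b →
      (∀ R h, 1 ≤ h → low W β C R (c + 1) h ≤ cnt q R h) →
      ∃ pos, (∀ m, Fam C β m pos) ∧ ∃ r, 1 ≤ r ∧ r ≤ k ∧ a ≤ pos c r ∧ pos (c + 1) r ≤ b := by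
    intro q hq hqp hqj hl
    have hext := hF.extend hc hq hqp (by
      intro R
      have h1 := hl R 1 le_rfl
      have h2 := lower_step W (fun m => cnt β R m) C (c + 1) 0
      rw [if_neg (hG.zero_notMem (by omega)), lower_zero C (cntN_zero hW R), zero_add] at h2
      unfold low at h1
      omega)
    obtain ⟨pos', hF', hag⟩ := hG.extend_right hW (by omega) hext (by simpa using hl)
    refine ⟨pos', hF', j, hj1, hjk, ?_, ?_⟩
    · rw [hag c (by omega), Function.update_of_ne (by omega), ← hj]
      exact hwpos j (by omega)
    · rw [hag (c + 1) le_rfl, Function.update_self]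
      exact hqj
  have hE : (insert a (C (c + 1))).erase a = C (c + 1) := Finset.erase_insert haC
  rcases Nat.eq_zero_or_pos b with hb0 | hb0
  · apply fin (Function.update w j 0)
    · have := hw.word.erase (j := j) (by omega)
      rwa [hj, hE] at this
    · intro r
      by_cases e : r = j
      · subst e; simp
      · rw [Function.update_of_ne e]
        by_cases eZ : r = Z
        · have := hZlab Z (by omega) (by omega) rfl
          rw [eZ, this]; omega
        · exact hwpos r eZ
    · simp
    · intro R h hh
      have h1 := cnt_update w j 0 R h hj1
      have h2 := t.ge R h hh
      have h3 : j ≤ R → h ≤ a → _ := fun x y => hup R x h (by omega) y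
      rw [hj] at h1
      split_ifs at * <;> omega
  · have hZR : cnt w R₀ b ≤ low W β C R₀ (c + 1) b := by
      rcases hR₀.2 with h | h
      · omega
      · refine le_trans ?_ h
        refine le_trans ?_ (hF.cnt_le_upper hc R₀ hb0)
        unfold cnt
        apply Finset.card_le_card
        intro r
        simp only [Finset.mem_filter, Finset.mem_Icc]
        rintro ⟨h1, h2⟩
        exact ⟨h1, h2.trans (hwpos r (by omega))⟩
    obtain ⟨hbC, i, hi, hwi, hlow⟩ := t.gap_lower hb0 hR₀.1 hZR
    have hiZ : i ≤ Z := by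
      by_contra hc'
      have := hw.bound i (by omega)
      omega
    have hji : j < i := by omega
    apply fin (Function.update (fun l => w (Equiv.swap j i l)) i 0)
    · have := (hw.word.swap hj1 (by omega : 1 ≤ i)).erase (j := i)
        (by rw [Equiv.swap_apply_right]; omega)
      rwa [Equiv.swap_apply_right, hj, hE] at this
    · intro r
      by_cases e : r = i
      · subst e; simp
      · rw [Function.update_of_ne e]
        by_cases e' : r = j
        · subst e'
          rw [Equiv.swap_apply_left, hwi]
          have := hwpos r (by omega)
          omega
        · rw [Equiv.swap_apply_of_ne_of_ne e' e]
          by_cases eZ : r = Z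
          · subst eZ
            have := hZlab r (by omega) (fun h1 h2 => hlow _ (by omega) _ (by omega) h2) rfl
            omega
          · exact hwpos r eZ
    · rw [Function.update_of_ne (by omega), Equiv.swap_apply_left]; omega
    · intro R h hh
      have h1 := cnt_update (fun l => w (Equiv.swap j i l)) i 0 R h (by omega)
      have h1' := cnt_swap w j i R h hj1 hji
      have h2 := t.ge R h hh
      have h3 : j ≤ R → b < h → h ≤ a → _ := fun x y z => hup R x h y z
      have h4 : i ≤ R → h ≤ b → _ := fun x y => hlow R x h hh y
      simp only [Equiv.swap_apply_right] at h1 h2 h3 h4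
      rw [hj] at h1 h1'
      rw [hwi] at h1'
      split_ifs at * <;> omega

lemma cnt_diff_le (p : ℕ → ℕ) {R R' h h' : ℕ} (hR : R' ≤ R) (hh : h ≤ h') :
    cnt p R h' + cnt p R' h ≤ cnt p R h + cnt p R' h' := by
  induction R, hR using Nat.le_induction with
  | base => omega
  | succ R hR ih =>
    rw [cnt_succ, cnt_succ]
    split_ifs <;> omega

lemma pinnedSwapLE_cnt {α β : ℕ → ℕ} (h : PinnedSwapLE α β) :
    (∀ R m, cnt β R m ≤ cnt α R m) ∧ (∃ Z, ∀ R, Z ≤ R → ∀ m, cnt β R m = cnt α R m) ∧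
      ∀ r, 1 ≤ r → (0 < α r ↔ 0 < β r) := by
  unfold PinnedSwapLE at h
  induction h with
  | refl => exact ⟨fun _ _ => le_rfl, ⟨0, fun _ _ _ => rfl⟩, fun _ _ => Iff.rfl⟩
  | tail _ hst ih =>
    obtain ⟨h1, ⟨Z, hZ⟩, h3⟩ := ih
    obtain ⟨i, j, hi, hij, hpi, hlt, rfl⟩ := hst
    rename_i γ _
    have hs := fun R m => cnt_swap γ i j R m hi hij
    refine ⟨fun R m => ?_, ⟨max Z j, fun R hR m => ?_⟩, fun r hr => ?_⟩
    · have := hs R m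
      have := h1 R m
      split_ifs at * <;> omega
    · have := hs R m
      have := hZ R (by omega) m
      split_ifs at * <;> omega
    · rw [← h3 r hr]
      beta_reduce
      by_cases e1 : r = i
      · subst e1; rw [Equiv.swap_apply_left]; omega
      · by_cases e2 : r = j
        · subst e2; rw [Equiv.swap_apply_right]; omega
        · rw [Equiv.swap_apply_of_ne_of_ne e1 e2]

/-- The data of a pair of compositions for which all prefix counts are comparable. -/
structure PrefixLE (β α : ℕ → ℕ) (Z : ℕ) : Prop where
  zero : α 0 = β 0
  supp : ∀ r, 1 ≤ r → (0 < β r ↔ 0 < α r)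
  le : ∀ R m, cnt β R m ≤ cnt α R m
  total : ∀ R, Z ≤ R → ∀ m, 1 ≤ m → cnt β R m = cnt α R m
  bound : ∀ r, Z ≤ r → 1 ≤ r → β r = 0

lemma PrefixLE.exists_step {β α : ℕ → ℕ} {Z : ℕ} (H : PrefixLE β α Z) (hne : β ≠ α) :
    ∃ i j, 1 ≤ i ∧ i < j ∧ 0 < β i ∧ β i < β j ∧ β j ≤ α i ∧ j < Z ∧
      PrefixLE (fun l => β (Equiv.swap i j l)) α Z := by
  have hex : ∃ i, β i ≠ α i := by
    by_contra hc
    push Not at hc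
    exact hne (funext hc)
  classical
  obtain ⟨i, hi, hmin⟩ : ∃ i, β i ≠ α i ∧ ∀ l < i, ¬ β l ≠ α l :=
    ⟨Nat.find hex, Nat.find_spec hex, fun l h => Nat.find_min hex h⟩
  have hi1 : 1 ≤ i := by
    rcases Nat.eq_zero_or_pos i with rfl | h
    · exact absurd H.zero.symm hi
    · exact h
  have hpre : ∀ m, cnt β (i - 1) m = cnt α (i - 1) m := fun m => cnt_congr (fun r _ h2 => by
    have := hmin r (by omega)
    push Not at this
    rw [this])
  have hsucc : ∀ (p : ℕ → ℕ) m, cnt p i m = cnt p (i - 1) m + if m ≤ p i then 1 else 0 := by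
    intro p m
    have := cnt_succ p (i - 1) m
    rwa [Nat.sub_add_cancel hi1] at this
  have hlt : β i < α i := by
    have h1 := H.le i (β i)
    rw [hsucc, hsucc, hpre, if_pos le_rfl] at h1
    split_ifs at h1 <;> omega
  have hbi : 0 < β i := (H.supp i hi1).2 (by omega)
  have hiZ : i < Z := by
    by_contra hc
    have := H.bound i (by omega) hi1
    omega
  have strict : ∀ R, i ≤ R → (∀ r, i < r → r ≤ R → ¬ (β i < β r ∧ β r ≤ α i)) →
      ∀ m, β i < m → m ≤ α i →
      cnt β R m + cnt α R (α i + 1) + 1 ≤ cnt α R m + cnt β R (α i + 1) := by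
    intro R hR hno m h1 h2
    have e1 := TightWord.cnt_diff (p := β) (R := R) (R' := i - 1) (h := m) (h' := α i + 1)
      (by omega) (by omega) (by
        intro r hr1 hr2 hr3
        by_cases e : r = i
        · subst e; omega
        · have := hno r (by omega) hr2
          omega)
    have e2 := cnt_diff_le α (R := R) (R' := i) (h := m) (h' := α i + 1) hR (by omega)
    rw [hsucc, hsucc, if_pos h2, if_neg (by omega)] at e2
    have e3 := hpre m
    have e4 := hpre (α i + 1)
    omega
  have hexj : ∃ j, i < j ∧ β i < β j ∧ β j ≤ α i := by
    by_contra hc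
    push Not at hc
    have := strict Z hiZ.le (fun r h1 _ h3 => by have := hc r h1 h3.1; omega) (β i + 1)
      (by omega) (by omega)
    have h1 := H.total Z le_rfl (β i + 1) (by omega)
    have h2 := H.total Z le_rfl (α i + 1) (by omega)
    omega
  obtain ⟨j, ⟨hij, hj1, hj2⟩, hjmin⟩ : ∃ j, (i < j ∧ β i < β j ∧ β j ≤ α i) ∧
      ∀ l < j, ¬ (i < l ∧ β i < β l ∧ β l ≤ α i) :=
    ⟨Nat.find hexj, Nat.find_spec hexj, fun l h => Nat.find_min hexj h⟩
  have hjZ : j < Z := by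
    by_contra hc
    have := H.bound j (by omega) (by omega)
    omega
  have hs := fun R m => cnt_swap β i j R m hi1 hij
  refine ⟨i, j, hi1, hij, hbi, hj1, hj2, hjZ, ?_, ?_, ?_, ?_, ?_⟩
  · rw [Equiv.swap_apply_of_ne_of_ne (by omega) (by omega)]; exact H.zero
  · intro r hr
    rw [← H.supp r hr]
    by_cases e1 : r = i
    · subst e1; rw [Equiv.swap_apply_left]; omega
    · by_cases e2 : r = j
      · subst e2; rw [Equiv.swap_apply_right]; omega
      · rw [Equiv.swap_apply_of_ne_of_ne e1 e2]
  · intro R m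
    have h1 := hs R m
    have h2 := H.le R m
    by_cases hx : i ≤ R ∧ R < j ∧ β i < m ∧ m ≤ β j
    · have h3 := strict R hx.1 (fun r h1 h2 h3 => hjmin r (by omega) ⟨h1, h3⟩) m hx.2.2.1 (by omega)
      have h4 := H.le R (α i + 1)
      split_ifs at h1 <;> omega
    · split_ifs at h1 <;> omega
  · intro R hR m hm
    have h1 := hs R m
    have h2 := H.total R hR m hm
    split_ifs at h1 <;> omega
  · intro r hr hr1
    rw [Equiv.swap_apply_of_ne_of_ne (by omega) (by omega)]
    exact H.bound r hr hr1

lemma PrefixLE.pinnedSwapLE {β α : ℕ → ℕ} {Z : ℕ} (H : PrefixLE β α Z) : PinnedSwapLE α β := by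
  set B := α 0 + ∑ r ∈ Finset.range Z, α r with hB
  have hαB : ∀ r, α r ≤ B := by
    intro r
    rcases Nat.eq_zero_or_pos r with rfl | hr
    · omega
    rcases lt_or_ge r Z with h | h
    · have := Finset.single_le_sum (f := α) (fun _ _ => Nat.zero_le _) (Finset.mem_range.2 h)
      omega
    · have h1 := H.bound r h hr
      have h2 := H.supp r hr
      omega
  let f : (ℕ → ℕ) → ℕ := fun p => ∑ R ∈ Finset.range (Z + 1), ∑ m ∈ Finset.range (B + 1), cnt p R m
  have key : ∀ n β, PrefixLE β α Z → f α ≤ f β + n → PinnedSwapLE α β := by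
    intro n
    induction n with
    | zero =>
      intro β H hf
      by_cases hne : β = α
      · subst hne; exact Relation.ReflTransGen.refl
      obtain ⟨i, j, h1, h2, h3, h4, h5, h6, h7⟩ := H.exists_step hne
      exfalso
      have hs := fun R m => cnt_swap β i j R m h1 h2
      have e1 : f β < f (fun l => β (Equiv.swap i j l)) := by
        have hle : ∀ R m, cnt β R m ≤ cnt (fun l => β (Equiv.swap i j l)) R m := fun R m => by
          have := hs R m
          split_ifs at this <;> omega
        apply Finset.sum_lt_sum
        · exact fun R _ => Finset.sum_le_sum fun m _ => hle R m
        · refine ⟨i, Finset.mem_range.2 (by omega), Finset.sum_lt_sum (fun m _ => hle i m) ?_⟩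
          have := hαB i
          refine ⟨β j, Finset.mem_range.2 (by omega), ?_⟩
          have := hs i (β j)
          rw [if_neg (by omega), if_pos ⟨le_rfl, h2, le_rfl⟩] at this
          omega
      have e2 : f (fun l => β (Equiv.swap i j l)) ≤ f α :=
        Finset.sum_le_sum fun R _ => Finset.sum_le_sum fun m _ => h7.le R m
      omega
    | succ n ih =>
      intro β H hf
      by_cases hne : β = α
      · subst hne; exact Relation.ReflTransGen.refl
      obtain ⟨i, j, h1, h2, h3, h4, h5, h6, h7⟩ := H.exists_step hne
      have hs := fun R m => cnt_swap β i j R m h1 h2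
      have e1 : f β < f (fun l => β (Equiv.swap i j l)) := by
        have hle : ∀ R m, cnt β R m ≤ cnt (fun l => β (Equiv.swap i j l)) R m := fun R m => by
          have := hs R m
          split_ifs at this <;> omega
        apply Finset.sum_lt_sum
        · exact fun R _ => Finset.sum_le_sum fun m _ => hle R m
        · refine ⟨i, Finset.mem_range.2 (by omega), Finset.sum_lt_sum (fun m _ => hle i m) ?_⟩
          have := hαB i
          refine ⟨β j, Finset.mem_range.2 (by omega), ?_⟩
          have := hs i (β j)
          rw [if_neg (by omega), if_pos ⟨le_rfl, h2, le_rfl⟩] at this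
          omega
      exact Relation.ReflTransGen.head ⟨i, j, h1, h2, h3, h4, rfl⟩ (ih _ h7 (by omega))
  exact key (f α) β H (by omega)

/-- The rows of the cells of `D` in column `m`. -/
def col (D : Diagram) (m : ℕ) : Finset ℕ := (D.filter (fun p => p.1 = m)).image Prod.snd

lemma mem_col {D : Diagram} {m h : ℕ} : h ∈ col D m ↔ (m, h) ∈ D := by
  unfold col
  simp only [Finset.mem_image, Finset.mem_filter, Prod.exists, exists_eq_right]

lemma upc_one {C : Finset ℕ} (h0 : 0 ∉ C) : upc C 1 = C.card := by
  unfold upc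
  rw [Finset.filter_true_of_mem]
  intro x hx
  by_contra h
  exact h0 ((by omega : x = 0) ▸ hx)

/-- The words of the columns of `D` labeled by `L`. -/
structure Words (D : Diagram) (α : ℕ → ℕ) (L : Cell → ℕ) (pos : ℕ → ℕ → ℕ) : Prop where
  cell : ∀ m g r, ((m, g) ∈ D ∧ L (m, g) = r) ↔ (1 ≤ m ∧ 1 ≤ g ∧ pos m r = g)
  part : ∀ m r, 1 ≤ m → 1 ≤ r → (m ≤ α r ↔ 0 < pos m r)

/-- Every cell lies in the first quadrant and the columns are good. -/
structure GoodD (D : Diagram) (β : ℕ → ℕ) : Prop where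
  quad : ∀ p ∈ D, 1 ≤ p.1 ∧ 1 ≤ p.2
  good : Good (col D) β

lemma exists_words {D : Diagram} {α : ℕ → ℕ} {L : Cell → ℕ} (h1 : SemiProper D α L)
    (h2 : IsPinned D L) : ∃ pos, Words D α L pos ∧ (∀ n, Fam (col D) α n pos) ∧
      (∃ Z, ∀ R, Z ≤ R → ∀ m, 1 ≤ m → cnt α R m = (col D m).card) ∧
      ∀ r, 1 ≤ r → (0 < α r ↔ r ∈ col D 1) := by
  classical
  obtain ⟨hq, hcol, hflag, hdesc⟩ := h1
  let pos : ℕ → ℕ → ℕ := fun m r =>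
    if h : ∃ g, (m, g) ∈ D ∧ L (m, g) = r then h.choose else 0
  have hcell : ∀ m g r, ((m, g) ∈ D ∧ L (m, g) = r) ↔ (1 ≤ m ∧ 1 ≤ g ∧ pos m r = g) := by
    intro m g r
    constructor
    · rintro ⟨hD, hL⟩
      have hex : ∃ g, (m, g) ∈ D ∧ L (m, g) = r := ⟨g, hD, hL⟩
      have hm := (hq _ hD).1
      refine ⟨hm, (hq _ hD).2, ?_⟩
      have e : pos m r = hex.choose := dif_pos hex
      have hsp := hex.choose_spec
      rw [e]
      have := (hcol m hm).1 (show _ ∈ {p : Cell | p ∈ D ∧ p.1 = m} from ⟨hsp.1, rfl⟩)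
        (show _ ∈ {p : Cell | p ∈ D ∧ p.1 = m} from ⟨hD, rfl⟩) (hsp.2.trans hL.symm)
      exact congrArg Prod.snd this
    · rintro ⟨hm, hg, e⟩
      by_cases hex : ∃ g, (m, g) ∈ D ∧ L (m, g) = r
      · have e' : pos m r = hex.choose := dif_pos hex
        rw [← e, e']
        exact hex.choose_spec
      · have e' : pos m r = 0 := dif_neg hex
        omega
  have hpart : ∀ m r, 1 ≤ m → 1 ≤ r → (m ≤ α r ↔ 0 < pos m r) := by
    intro m r hm hr
    have hset := (hcol m hm).2
    constructor
    · intro hle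
      have : r ∈ {r : ℕ | 1 ≤ r ∧ m ≤ α r} := ⟨hr, hle⟩
      rw [← hset] at this
      obtain ⟨⟨p1, p2⟩, ⟨hpD, rfl⟩, hpL⟩ := this
      obtain ⟨_, h2, h3⟩ := (hcell _ _ _).1 ⟨hpD, hpL⟩
      change 0 < pos p1 r
      omega
    · intro hpos
      have hc := (hcell m (pos m r) r).2 ⟨hm, hpos, rfl⟩
      have : r ∈ L '' {p : Cell | p ∈ D ∧ p.1 = m} := ⟨_, ⟨hc.1, rfl⟩, hc.2⟩
      rw [hset] at this
      exact this.2
  have hlab : ∀ m r, 1 ≤ m → pos m r ≠ 0 → 1 ≤ r := by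
    intro m r hm hp
    have hc := (hcell m (pos m r) r).2 ⟨hm, by omega, rfl⟩
    have := hflag _ hc.1
    rw [hc.2] at this
    exact le_trans (by simp only; omega) this
  have hword : ∀ m, 1 ≤ m → IsWord (col D m) (pos m) := by
    intro m hm
    refine ⟨?_, ?_, ?_⟩
    · by_contra hne
      exact absurd (hlab m 0 hm hne) (by omega)
    · intro h
      rw [mem_col]
      constructor
      · intro hD
        have := (hcell m h _).1 ⟨hD, rfl⟩
        exact ⟨this.2.1, _, this.2.2⟩
      · rintro ⟨hh, r, e⟩
        exact ((hcell m h r).2 ⟨hm, hh, e⟩).1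
    · intro r r' e hne
      have c1 := (hcell m (pos m r) r).2 ⟨hm, by omega, rfl⟩
      have c2 := (hcell m (pos m r) r').2 ⟨hm, by omega, e.symm⟩
      rw [← c1.2, ← c2.2]
  have hcnt : ∀ m, 1 ≤ m → ∀ R, cnt α R m = cnt (pos m) R 1 := by
    intro m hm R
    exact cnt_congr fun r hr _ => hpart m r hm hr
  have hpin1 : ∀ r, pos 1 r = 0 ∨ pos 1 r = r := by
    intro r
    rcases Nat.eq_zero_or_pos (pos 1 r) with h | h
    · exact Or.inl h
    · right
      have c1 := (hcell 1 (pos 1 r) r).2 ⟨le_rfl, h, rfl⟩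
      have := h2 _ c1.1 rfl
      rw [c1.2] at this
      exact this.symm
  refine ⟨pos, ⟨hcell, hpart⟩, fun n => ⟨hpin1, fun m hm _ => hword m hm, ?_, ?_⟩, ?_, ?_⟩
  · intro m hm _ r
    rcases Nat.eq_zero_or_pos (pos (m + 1) r) with h | h
    · omega
    · have hr := hlab (m + 1) r (by omega) (by omega)
      have h3 := (hpart m r hm hr).1 (by have := (hpart (m + 1) r (by omega) hr).2 h; omega)
      have c1 := (hcell m _ r).2 ⟨hm, h3, rfl⟩
      have c2 := (hcell (m + 1) _ r).2 ⟨by omega, h, rfl⟩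
      exact hdesc _ c1.1 _ c2.1 (c1.2.trans c2.2.symm) (Nat.lt_succ_self m)
  · intro m hm _ R
    exact (hcnt m hm R).le
  · refine ⟨D.sup L, fun R hR m hm => ?_⟩
    rw [hcnt m hm, (hword m hm).cnt_eq_upc (Z := D.sup L + 1) ?_ (by omega) le_rfl, upc_one]
    · intro h0
      rw [mem_col] at h0
      have := (hq _ h0).2
      simp at this
    · intro r hr
      by_contra hne
      have c1 := (hcell m (pos m r) r).2 ⟨hm, by omega, rfl⟩
      have := Finset.le_sup (f := L) c1.1
      rw [c1.2] at this
      omega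
  · intro r hr
    rw [show 0 < α r ↔ 1 ≤ α r from Iff.rfl, hpart 1 r le_rfl hr, mem_col]
    constructor
    · intro h
      have hc := ((hcell 1 _ r).2 ⟨le_rfl, h, rfl⟩).1
      rcases hpin1 r with h' | h'
      · omega
      · rwa [h'] at hc
    · intro h
      have := h2 _ h rfl
      have := ((hcell 1 r r).1 ⟨h, this⟩).2.2
      omega

lemma SemiProper.exists_good {D : Diagram} {α β : ℕ → ℕ} {L : Cell → ℕ} (h1 : SemiProper D α L)
    (h2 : IsPinned D L) (h3 : PinnedSwapLE α β) :
    GoodD D β ∧ ∃ pos, Words D α L pos ∧ ∀ n, Fam (col D) β n pos := by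
  obtain ⟨pos, hw, hF, ⟨Z, hZ⟩, hfst⟩ := exists_words h1 h2
  obtain ⟨e1, ⟨Z', e2⟩, e3⟩ := pinnedSwapLE_cnt h3
  have hF' : ∀ n, Fam (col D) β n pos := fun n => ⟨(hF n).pin, (hF n).word, (hF n).dom,
    fun m a b R => (e1 R m).trans ((hF n).lab m a b R)⟩
  refine ⟨⟨h1.1, ⟨pos, hF'⟩, ⟨max Z Z', fun R hR m hm => ?_⟩, fun r hr => ?_⟩, pos, hw, hF'⟩
  · rw [e2 R (by omega), hZ R (by omega) m hm]
  · rw [← e3 r hr, hfst r hr]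

lemma GoodD.exists_semiProper {D : Diagram} {β : ℕ → ℕ} (hG : GoodD D β) {W : ℕ}
    (hW : ∀ r, 1 ≤ r → β r < W) {pos : ℕ → ℕ → ℕ} (hF : ∀ n, Fam (col D) β n pos) :
    ∃ α L, SemiProper D α L ∧ IsPinned D L ∧ PinnedSwapLE α β ∧ Words D α L pos := by
  classical
  have hword : ∀ m, 1 ≤ m → IsWord (col D m) (pos m) := fun m hm => (hF m).word m hm le_rfl
  have hdom : ∀ m, 1 ≤ m → ∀ r, pos (m + 1) r ≤ pos m r := fun m hm r =>
    (hF (m + 1)).dom m hm (by omega) r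
  have hdom' : ∀ m m', 1 ≤ m → m ≤ m' → ∀ r, pos m' r ≤ pos m r := by
    intro m m' hm hmm r
    induction m', hmm using Nat.le_induction with
    | base => exact le_rfl
    | succ n hn ih => exact (hdom n (by omega) r).trans ih
  have hpin := (hF 1).pin
  have hzero : ∀ m, 1 ≤ m → W ≤ m → ∀ r, pos m r = 0 := by
    intro m hm hmW r
    by_contra hne
    have := ((hword m hm).mem (pos m r)).2 ⟨by omega, r, rfl⟩
    rw [hG.good.empty hW hm hmW] at this
    simp at this
  have hα : ∀ r, ∃ d, ∀ m, 1 ≤ m → (m ≤ d ↔ 0 < pos m r) := by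
    intro r
    have hex : ∃ d, pos (d + 1) r = 0 := ⟨W, hzero _ (by omega) (by omega) r⟩
    refine ⟨Nat.find hex, fun m hm => ⟨fun h => ?_, fun h => ?_⟩⟩
    · have := Nat.find_min hex (m := m - 1) (by omega)
      rw [Nat.sub_add_cancel hm] at this
      omega
    · by_contra hc
      have h1 := Nat.find_spec hex
      have := hdom' (Nat.find hex + 1) m (by omega) (by omega) r
      omega
  choose d hd using hα
  have hL : ∀ p : Cell, ∃ r, p ∈ D → pos p.1 r = p.2 := by
    intro p
    by_cases hp : p ∈ D
    · obtain ⟨_, r, hr⟩ := ((hword p.1 (hG.quad p hp).1).mem p.2).1 (mem_col.2 hp)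
      exact ⟨r, fun _ => hr⟩
    · exact ⟨0, fun h => absurd h hp⟩
  choose L hL using hL
  have hcell : ∀ m g r, ((m, g) ∈ D ∧ L (m, g) = r) ↔ (1 ≤ m ∧ 1 ≤ g ∧ pos m r = g) := by
    intro m g r
    constructor
    · rintro ⟨hD, rfl⟩
      exact ⟨(hG.quad _ hD).1, (hG.quad _ hD).2, hL _ hD⟩
    · rintro ⟨hm, hg, e⟩
      have hD : (m, g) ∈ D := mem_col.1 (((hword m hm).mem g).2 ⟨hg, r, e⟩)
      refine ⟨hD, (hword m hm).inj _ _ ?_ ?_⟩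
      · rw [hL _ hD, e]
      · rw [hL _ hD]; simp only; omega
  let α : ℕ → ℕ := fun r => if r = 0 then β 0 else d r
  have hαd : ∀ r, 1 ≤ r → α r = d r := fun r hr => if_neg (by omega)
  have hpart : ∀ m r, 1 ≤ m → 1 ≤ r → (m ≤ α r ↔ 0 < pos m r) := by
    intro m r hm hr
    rw [hαd r hr]
    exact hd r m hm
  have hcnt : ∀ m, 1 ≤ m → ∀ R, cnt α R m = cnt (pos m) R 1 := by
    intro m hm R
    exact cnt_congr fun r hr _ => hpart m r hm hr
  have hpos1 : ∀ m, 1 ≤ m → ∀ r, pos m r ≠ 0 → pos 1 r = r := by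
    intro m hm r hne
    have := hdom' 1 m le_rfl hm r
    rcases hpin r with h | h
    · omega
    · exact h
  refine ⟨α, L, ⟨hG.quad, fun m hm => ⟨?_, ?_⟩, ?_, ?_⟩, ?_, ?_, hcell, hpart⟩
  · rintro ⟨_, g⟩ ⟨hp, rfl⟩ ⟨m', g'⟩ ⟨hp', e'⟩ e
    simp only at e' hm
    subst e'
    have h1 := hL _ hp
    have h2 := hL _ hp'
    rw [e, h2] at h1
    simp only at h1
    rw [h1]
  · ext r
    simp only [Set.mem_image, Set.mem_ofPred_eq]
    constructor
    · rintro ⟨⟨m', g⟩, ⟨hp, e⟩, hr⟩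
      simp only at e
      subst e
      obtain ⟨_, h2, h3⟩ := (hcell _ _ _).1 ⟨hp, hr⟩
      have hr1 : 1 ≤ r := (hword _ hm).pos_of (r := r) (by omega)
      exact ⟨hr1, (hpart _ r hm hr1).2 (by omega)⟩
    · rintro ⟨hr1, hr⟩
      have := (hcell m _ r).2 ⟨hm, (hpart m r hm hr1).1 hr, rfl⟩
      exact ⟨_, ⟨this.1, rfl⟩, this.2⟩
  · intro p hp
    have h1 := hL p hp
    have h2 := hG.quad p hp
    have h3 := hpos1 p.1 h2.1 (L p) (by omega)
    have := hdom' 1 p.1 le_rfl h2.1 (L p)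
    omega
  · intro p hp q hq e hlt
    have h1 := hL p hp
    have h2 := hL q hq
    have := hdom' p.1 q.1 (hG.quad p hp).1 hlt.le (L p)
    rw [e] at this h1
    omega
  · intro p hp e
    have h1 := hL p hp
    have h2 := hpos1 1 le_rfl (L p) (by have := (hG.quad p hp).2; rw [e] at h1; omega)
    rw [e, h2] at h1
    exact h1
  · obtain ⟨Z, hZ⟩ := hG.good.total
    apply PrefixLE.pinnedSwapLE (Z := Z + 1)
    have hle : ∀ R m, cnt β R m ≤ cnt α R m := by
      intro R m
      rcases Nat.eq_zero_or_pos m with rfl | hm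
      · exact (cnt_congr fun r _ _ => by simp).le
      · rw [hcnt m hm]; exact (hF m).lab m hm le_rfl R
    refine ⟨rfl, fun r hr => ?_, hle, fun R hR m hm => ?_, fun r hr hr1 => ?_⟩
    · rw [hG.good.first r hr, show 0 < α r ↔ 1 ≤ α r from Iff.rfl, hpart 1 r le_rfl hr,
        (hword 1 le_rfl).mem]
      constructor
      · rintro ⟨_, r', hr'⟩
        have := hpos1 1 le_rfl r' (by omega)
        have : r' = r := by omega
        subst this
        omega
      · intro h
        exact ⟨hr, r, hpos1 1 le_rfl r (by omega)⟩
    · apply le_antisymm (hle R m)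
      rw [hcnt m hm, hZ R (by omega) m hm, ← upc_one (hG.good.zero_notMem hm)]
      exact (hword m hm).cnt_le_upc R le_rfl
    · obtain ⟨r, rfl⟩ : ∃ r', r = r' + 1 := ⟨r - 1, by omega⟩
      have h1 := hZ r (by omega) 1 le_rfl
      have h2 := hZ (r + 1) (by omega) 1 le_rfl
      rw [cnt_succ] at h2
      split_ifs at h2 <;> omega

lemma low_congr {β : ℕ → ℕ} {C C' : ℕ → Finset ℕ} {W : ℕ} (hW : ∀ r, 1 ≤ r → β r < W) (R : ℕ)
    {m h : ℕ} (H : ∀ n, m ≤ n → ∀ g, g < h → (g ∈ C n ↔ g ∈ C' n)) :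
    low W β C R m h = low W β C' R m h :=
  lower_congr (cntN_zero hW R) (cntN_zero hW R) (fun _ _ => rfl) H

lemma Fam.gap {C : ℕ → Finset ℕ} {β : ℕ → ℕ} {pos : ℕ → ℕ → ℕ} (hF : ∀ n, Fam C β n pos) {W : ℕ}
    (hW : ∀ r, 1 ≤ r → β r < W) {k c a r h : ℕ} (hc : 1 ≤ c) (hr : 1 ≤ r) (hrk : r ≤ k)
    (ha : a ≤ pos c r) (hb : pos (c + 1) r < h) (hh : h ≤ a) : Gap W k β C c h := by
  intro R hR
  have h1 := low_le_cnt hF hW R (by omega : 1 ≤ c + 1) h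
  have h2 := (hF c).cnt_le_upper hc R (by omega : 1 ≤ h)
  have h3 := cnt_update (pos (c + 1)) r a R h hr
  have h4 : cnt (Function.update (pos (c + 1)) r a) R h ≤ cnt (pos c) R h := by
    refine cnt_mono_word (fun l _ => ?_) R h
    by_cases e : l = r
    · subst e; simpa using ha
    · rw [Function.update_of_ne e]
      exact (hF (c + 1)).dom c hc (by omega) l
  rw [if_neg (by omega), if_pos ⟨by omega, hh⟩] at h3
  omega

lemma HasAbut.exists_words {k : ℕ} {β α : ℕ → ℕ} {T : Diagram} {c a r : ℕ} {L : Cell → ℕ}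
    (h : HasAbut k β T (c + 1, a) r α L) (ha : 1 ≤ a) :
    GoodD T β ∧ 1 ≤ c ∧ a ∉ col T (c + 1) ∧ 1 ≤ r ∧ r ≤ k ∧ ∃ pos, Words T α L pos ∧
      (∀ n, Fam (col T) β n pos) ∧ a ≤ pos c r ∧ pos (c + 1) r < a ∧
      (α r + 1 = c + 1 ↔ pos (c + 1) r = 0) := by
  obtain ⟨h1, h2, h3, hr, hrk, hx, hc, ⟨⟨p1, p2⟩, hpD, hp1, hpL, hpa⟩, hor⟩ := h
  obtain ⟨hG, pos, hw, hF⟩ := h1.exists_good h2 h3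
  simp only at hc hp1 hpa hor
  obtain rfl : p1 = c := by omega
  have hp := ((hw.cell _ _ _).1 ⟨hpD, hpL⟩).2.2
  have hc1 : 1 ≤ p1 := by omega
  have i1 := hw.part p1 r hc1 hr
  have i2 := hw.part (p1 + 1) r (by omega) hr
  refine ⟨hG, hc1, fun hm => hx (mem_col.1 hm), hr, hrk, pos, hw, hF, by omega, ?_, by omega⟩
  rcases hor with e | ⟨⟨q1, q2⟩, hqD, hq1, hqL, hqa⟩
  · omega
  · simp only at hq1 hqa
    subst hq1
    have := ((hw.cell _ _ _).1 ⟨hqD, hqL⟩).2.2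
    omega

lemma GoodD.exists_hasAbut {T : Diagram} {β : ℕ → ℕ} (hG : GoodD T β) {W : ℕ}
    (hW : ∀ r, 1 ≤ r → β r < W) {k c a b : ℕ} (hc : 1 ≤ c) (haC : a ∉ col T (c + 1))
    (hba : b < a) (hgap : ∀ h, b < h → h ≤ a → Gap W k β (col T) c h)
    (hb : b = 0 ∨ ¬ Gap W k β (col T) c b) :
    ∃ α L r pos, HasAbut k β T (c + 1, a) r α L ∧ Words T α L pos ∧ pos (c + 1) r ≤ b ∧
      (pos (c + 1) r = 0 → α r + 1 = c + 1) := by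
  obtain ⟨pos, hF, r, hr, hrk, h1, h2⟩ := hG.good.exists_abut hW hc (by omega) haC hba hgap hb
  obtain ⟨α, L, e1, e2, e3, hw⟩ := hG.exists_semiProper hW hF
  have i1 := hw.part c r hc hr
  have i2 := hw.part (c + 1) r (by omega) hr
  have c1 := (hw.cell c _ r).2 ⟨hc, by omega, rfl⟩
  refine ⟨α, L, r, pos, ⟨e1, e2, e3, hr, hrk, fun hm => haC (mem_col.2 hm), by simp only; omega,
    ⟨_, c1.1, rfl, c1.2, h1⟩, ?_⟩, hw, h2, by omega⟩
  rcases Nat.eq_zero_or_pos (pos (c + 1) r) with h | h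
  · left
    simp only
    omega
  · right
    have c2 := (hw.cell (c + 1) _ r).2 ⟨by omega, h, rfl⟩
    exact ⟨_, c2.1, rfl, c2.2, by simp only; omega⟩

lemma exists_bottom (P : ℕ → Prop) {a : ℕ} (ha : 1 ≤ a) (hP : P a) :
    ∃ b, b < a ∧ (∀ h, b < h → h ≤ a → P h) ∧ (b = 0 ∨ ¬ P b) := by
  induction a, ha using Nat.le_induction with
  | base =>
    refine ⟨0, by omega, fun h h1 h2 => ?_, Or.inl rfl⟩
    obtain rfl : h = 1 := by omega
    exact hP
  | succ n hn ih =>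
    by_cases h : P n
    · obtain ⟨b, h1, h2, h3⟩ := ih h
      refine ⟨b, by omega, fun g g1 g2 => ?_, h3⟩
      rcases g2.eq_or_lt with rfl | hlt
      · exact hP
      · exact h2 g g1 (by omega)
    · refine ⟨n, by omega, fun g g1 g2 => ?_, Or.inr h⟩
      obtain rfl : g = n + 1 := by omega
      exact hP

/-- The position at which an abutting label is bumped is the end of the run of gaps. -/
lemma GoodD.bump_gap {T : Diagram} {β : ℕ → ℕ} (hG : GoodD T β) {W : ℕ}
    (hW : ∀ r, 1 ≤ r → β r < W) {k c a b : ℕ} (hc : 1 ≤ c) (haC : a ∉ col T (c + 1))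
    (hba : b < a) (hb1 : 1 ≤ b) (hgap : ∀ h, b < h → h ≤ a → Gap W k β (col T) c h)
    (hnoland : ¬ ∃ α' L' r', HasAbut k β T (c + 1, a) r' α' L' ∧ α' r' + 1 = c + 1)
    (hlow : ∀ (α' : ℕ → ℕ) (L' : Cell → ℕ) (r' : ℕ) (y' : Cell),
      HasAbut k β T (c + 1, a) r' α' L' → y' ∈ T → y'.1 = c + 1 → L' y' = r' → b ≤ y'.2) :
    ¬ Gap W k β (col T) c b := by
  intro hgb
  obtain ⟨b', h1, h2, h3⟩ := exists_bottom (fun h => Gap W k β (col T) c h) hb1 hgb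
  obtain ⟨α, L, r, pos, hab, hw, h4, h5⟩ := hG.exists_hasAbut hW hc haC (by omega : b' < a)
    (fun h g1 g2 => by
      rcases le_or_gt h b with h' | h'
      · exact h2 h g1 h'
      · exact hgap h h' g2) h3
  rcases Nat.eq_zero_or_pos (pos (c + 1) r) with h | h
  · exact hnoland ⟨α, L, r, hab, h5 h⟩
  · have c2 := (hw.cell (c + 1) _ r).2 ⟨by omega, h, rfl⟩
    have := hlow α L r _ hab c2.1 rfl c2.2
    simp only at this
    omega

lemma GoodD.not_gap {T : Diagram} {β : ℕ → ℕ} (hG : GoodD T β) {W : ℕ}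
    (hW : ∀ r, 1 ≤ r → β r < W) {k c a : ℕ} (hc : 1 ≤ c) (ha : 1 ≤ a) (haC : a ∉ col T (c + 1))
    (hno : ¬ ∃ α L r, HasAbut k β T (c + 1, a) r α L) : ¬ Gap W k β (col T) c a := by
  intro hga
  obtain ⟨b', h1, h2, h3⟩ := exists_bottom (fun h => Gap W k β (col T) c h) ha hga
  obtain ⟨α, L, r, pos, hab, _⟩ := hG.exists_hasAbut hW hc haC h1 h2 h3
  exact hno ⟨α, L, r, hab⟩

lemma Rect.goodD {k : ℕ} {β : ℕ → ℕ} {T U : Diagram} {x z : Cell} (h : Rect k β T x U z) :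
    GoodD T β := by
  induction h with
  | land T x α L r h _ => exact (h.1.exists_good h.2.1 h.2.2.1).1
  | bump T x α L r y h => exact (h.1.exists_good h.2.1 h.2.2.1).1
  | pass T x _ y _ _ _ _ _ _ _ _ ih => exact ih

lemma col_insert (T : Diagram) (c a m : ℕ) :
    col (insert (c, a) T) m = if m = c then insert a (col T c) else col T m := by
  ext h
  rw [mem_col, Finset.mem_insert, Prod.mk.injEq]
  split_ifs with e
  · subst e
    rw [Finset.mem_insert, mem_col]
    simp
  · rw [mem_col]
    simp [e]

lemma col_erase (T : Diagram) (c a m : ℕ) :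
    col (T.erase (c, a)) m = if m = c then (col T c).erase a else col T m := by
  ext h
  rw [mem_col, Finset.mem_erase, Ne, Prod.mk.injEq]
  split_ifs with e
  · subst e
    rw [Finset.mem_erase, mem_col]
    simp
  · rw [mem_col]
    simp [e]

lemma col_exchange (T : Diagram) (c a b m : ℕ) :
    col (insert (c, a) (T.erase (c, b))) m =
      if m = c then insert a ((col T c).erase b) else col T m := by
  rw [col_insert, col_erase, if_pos rfl, col_erase]
  split_ifs <;> rfl

lemma gap_insert {C C' : ℕ → Finset ℕ} {β : ℕ → ℕ} (hG : Good C β) {W : ℕ}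
    (hW : ∀ r, 1 ≤ r → β r < W) {k c a b : ℕ} (haC : a ∉ C (c + 1))
    (hcol : ∀ g, b < g → (g ∈ C' (c + 1) ↔ g ∈ insert a (C (c + 1))))
    (hright : ∀ m, c + 1 < m → C' m = C m)
    (hleft : ∀ R h, b < h → upper C' R c h = upper C R c h)
    (hgap : ∀ h, b < h → h ≤ a → Gap W k β C c h) {h : ℕ} (hbh : b < h) (hha : h ≤ a) :
    Gap W k β C' (c + 1) h := by
  intro R hR
  have e1 : low W β C' R (c + 1 + 1) h = low W β C R (c + 1 + 1) h :=
    low_congr hW R fun n hn g _ => by rw [hright n (by omega)]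
  have e2 : low W β C R (c + 1 + 1) h ≤ low W β C R (c + 1) h :=
    lower_col C (cntN_zero hW R) (cntN_anti β R) (c + 1) h
  obtain ⟨h', hh', e3⟩ := upper_mem C' R c h
  rw [hleft R h' (by omega), seg_congr (fun g g1 _ => hcol g (by omega)), seg_insert haC] at e3
  rcases lt_or_ge a h' with hlt | hge
  · rw [if_pos ⟨hha, hlt⟩] at e3
    have := upper_le C R c hh'
    have := hG.low_le_upper hW R (by omega : 1 ≤ c + 1) (by omega : 1 ≤ h)
    omega
  · have h1 := hgap h' (by omega) hge R hR
    have h2 : low W β C R (c + 1) h ≤ low W β C R (c + 1) h' + seg (C (c + 1)) h h' :=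
      lower_seg _ _ _ _ hh'
    omega

lemma upper_succ_congr {C C' : ℕ → Finset ℕ} {R m h : ℕ}
    (H : ∀ h', h ≤ h' → upper C' R m h' = upper C R m h')
    (hm : ∀ g, h ≤ g → (g ∈ C' (m + 1) ↔ g ∈ C (m + 1))) :
    upper C' R (m + 1) h = upper C R (m + 1) h := by
  apply le_antisymm
  · obtain ⟨h', hh', e⟩ := upper_mem C R m h
    have := upper_le C' R m hh'
    rw [H h' hh', seg_congr (fun g g1 _ => hm g g1)] at this
    omega
  · obtain ⟨h', hh', e⟩ := upper_mem C' R m h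
    have := upper_le C R m hh'
    rw [H h' hh', seg_congr (fun g g1 _ => hm g g1)] at e
    omega

/-- What a run from position `(j, a)` landing in column `cx` does to the columns `C`: the function
`A` records the row in which the run moves through each column. -/
structure RunSpec (W k : ℕ) (β : ℕ → ℕ) (C C' : ℕ → Finset ℕ) (j a cx : ℕ) (A : ℕ → ℕ) : Prop where
  start : A j = a
  zero : ∀ m, m < cx → A m = 0
  pos : 1 ≤ A cx
  two : 2 ≤ cx
  le : cx ≤ j
  mono : ∀ m, m < j → A m ≤ A (m + 1)
  out : ∀ m, m < cx ∨ j < m → C' m = C m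
  touch : ∀ c, cx ≤ c → c < j →
    ∃ R, k ≤ R ∧ upper C' R c (A c + 1) ≤ low W β C' R (c + 1) (A c + 1)
  gap : ∀ m, cx ≤ m → m ≤ j → ∀ h, A (m - 1) < h → h ≤ A m → Gap W k β C' m h
  above : ∀ m, cx ≤ m → m ≤ j → ∀ h, A m < h → ∀ R, upper C' R m h = upper C R m h
  stay : ¬ Gap W k β C (j - 1) a → cx < j ∧ A (j - 1) = a ∧ C' j = C j
  gap_before : ∀ c, cx ≤ c + 1 → c < j → ∀ h, A c < h → h ≤ A (c + 1) → Gap W k β C c h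
  not_gap : ∀ c, cx ≤ c → c < j → ¬ Gap W k β C c (A c)

lemma RunSpec.mono' {W k : ℕ} {β : ℕ → ℕ} {C C' : ℕ → Finset ℕ} {j a cx : ℕ} {A : ℕ → ℕ}
    (H : RunSpec W k β C C' j a cx A) {m m' : ℕ} (h : m ≤ m') (hm : m' ≤ j) : A m ≤ A m' := by
  induction m', h using Nat.le_induction with
  | base => exact le_rfl
  | succ n hn ih => exact (ih (by omega)).trans (H.mono n (by omega))

lemma RunSpec.land {C : ℕ → Finset ℕ} {β : ℕ → ℕ} (hG : Good C β) {W : ℕ}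
    (hW : ∀ r, 1 ≤ r → β r < W) {C' : ℕ → Finset ℕ} {k c a : ℕ} (hc : 1 ≤ c) (ha : 1 ≤ a)
    (haC : a ∉ C (c + 1)) (hgap : ∀ h, 0 < h → h ≤ a → Gap W k β C c h)
    (hC : ∀ m, m ≠ c + 1 → C' m = C m) (hC1 : C' (c + 1) = insert a (C (c + 1))) :
    RunSpec W k β C C' (c + 1) a (c + 1) (fun m => if m = c + 1 then a else 0) := by
  have hg : ∀ h, 0 < h → h ≤ a → Gap W k β C' (c + 1) h := fun h => gap_insert hG hW haC
    (fun g _ => by rw [hC1]) (fun m hm => hC m (by omega))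
    (fun R h _ => upper_congr R fun n _ hn g _ => by rw [hC n (by omega)]) hgap
  refine ⟨by simp, fun m hm => if_neg (by omega), by simpa using ha, by omega, le_rfl,
    fun m hm => ?_, fun m hm => hC m (by omega), fun m _ _ => by omega, ?_, ?_, ?_, ?_,
    fun m _ _ => by omega⟩
  · rw [if_neg (by omega)]; omega
  · intro m h1 h2 h g1 g2
    obtain rfl : m = c + 1 := by omega
    rw [if_pos rfl] at g2
    exact hg h (by omega) g2
  · intro m h1 h2 h g1 R
    obtain rfl : m = c + 1 := by omega
    rw [if_pos rfl] at g1
    refine upper_congr R fun n _ hn g hg => ?_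
    by_cases e : n = c + 1
    · subst e
      rw [hC1, Finset.mem_insert]
      constructor
      · rintro (rfl | h)
        · omega
        · exact h
      · exact Or.inr
    · rw [hC n e]
  · intro h
    exact absurd (hgap a ha le_rfl) h
  · intro m h1 h2 h g1 g2
    obtain rfl : m = c := by omega
    rw [if_pos rfl] at g2
    exact hgap h (by omega) g2

lemma RunSpec.bump {C : ℕ → Finset ℕ} {β : ℕ → ℕ} (hG : Good C β) {W : ℕ}
    (hW : ∀ r, 1 ≤ r → β r < W) {C₁ C' : ℕ → Finset ℕ} {k c a b cx : ℕ}
    (haC : a ∉ C (c + 1)) (hba : b < a) (hgap : ∀ h, b < h → h ≤ a → Gap W k β C c h)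
    (hb : ¬ Gap W k β C c b) (hC : ∀ m, m ≠ c + 1 → C₁ m = C m)
    (hC1 : C₁ (c + 1) = insert a ((C (c + 1)).erase b)) {A : ℕ → ℕ}
    (H : RunSpec W k β C₁ C' (c + 1) b cx A) :
    RunSpec W k β C C' (c + 1) a cx (fun m => if m = c + 1 then a else A m) := by
  have hlow : ∀ R m h, h ≤ b → low W β C₁ R m h = low W β C R m h := by
    intro R m h hh
    refine low_congr hW R fun n hn g hg => ?_
    by_cases e : n = c + 1
    · subst e
      rw [hC1, Finset.mem_insert, Finset.mem_erase]
      constructor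
      · rintro (rfl | h)
        · omega
        · exact h.2
      · exact fun h => Or.inr ⟨by omega, h⟩
    · rw [hC n e]
  have hup : ∀ R m h, m ≤ c → upper C₁ R m h = upper C R m h := by
    intro R m h hm
    exact upper_congr R fun n _ hn g _ => by rw [hC n (by omega)]
  have hgapiff : ∀ m h, m ≤ c → h ≤ b → (Gap W k β C₁ m h ↔ Gap W k β C m h) := by
    intro m h hm hh
    unfold Gap
    simp only [hlow _ _ h hh, hup _ _ h hm]
  obtain ⟨hcx, hAc, hstay⟩ := H.stay (by
    rw [Nat.add_sub_cancel, hgapiff c b le_rfl le_rfl]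
    exact hb)
  rw [Nat.add_sub_cancel] at hAc
  have hA : ∀ m, m ≤ c → A m ≤ b := fun m hm => hAc ▸ H.mono' hm (by omega)
  have hleft : ∀ R h, b < h → upper C' R c h = upper C R c h := by
    intro R h hh
    rw [H.above c (by omega) (by omega) h (by omega) R, hup R c h le_rfl]
  have hcolm : ∀ g, b < g → (g ∈ C' (c + 1) ↔ g ∈ insert a (C (c + 1))) := by
    intro g hg
    rw [hstay, hC1]
    simp only [Finset.mem_insert, Finset.mem_erase]
    have : g ≠ b := by omega
    tauto
  have hA' : ∀ m, m ≤ c → (if m = c + 1 then a else A m) = A m := fun m hm =>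
    if_neg (by omega)
  refine ⟨by simp, fun m hm => ?_, ?_, H.two, H.le, fun m hm => ?_, fun m hm => ?_, ?_, ?_, ?_,
    fun h => absurd (hgap a hba le_rfl) h, ?_, ?_⟩
  · rw [hA' m (by omega)]; exact H.zero m hm
  · rw [hA' cx (by omega)]; exact H.pos
  · rw [hA' m (by omega)]
    split_ifs with e
    · exact (hA m (by omega)).trans hba.le
    · exact H.mono m hm
  · rw [H.out m hm, hC m (by omega)]
  · intro m h1 h2
    rw [hA' m (by omega)]
    exact H.touch m h1 h2
  · intro m h1 h2 h
    rw [hA' (m - 1) (by omega)]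
    split_ifs with e
    · subst e
      rw [Nat.add_sub_cancel, hAc]
      exact gap_insert hG hW haC hcolm (fun m hm => by rw [H.out m (Or.inr hm), hC m (by omega)])
        hleft hgap
    · exact H.gap m h1 h2 h
  · intro m h1 h2 h g1 R
    split_ifs at g1 with e
    · subst e
      refine upper_succ_congr (fun h' hh' => hleft R h' (by omega)) fun g hg => ?_
      rw [hcolm g (by omega), Finset.mem_insert]
      constructor
      · rintro (rfl | h)
        · omega
        · exact h
      · exact Or.inr
    · rw [H.above m h1 h2 h g1 R, hup R m h (by omega)]
  · intro m h1 h2 h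
    rw [hA' m (by omega)]
    split_ifs with e
    · obtain rfl : m = c := by omega
      rw [hAc]
      exact hgap h
    · intro g1 g2
      rw [← hgapiff m h (by omega) (g2.trans (hA _ (by omega)))]
      exact H.gap_before m h1 h2 h g1 g2
  · intro m h1 h2
    rw [hA' m (by omega), ← hgapiff m _ (by omega) (hA m (by omega))]
    exact H.not_gap m h1 h2

lemma RunSpec.pass {C : ℕ → Finset ℕ} {β : ℕ → ℕ} (hG : Good C β) {W : ℕ}
    (hW : ∀ r, 1 ≤ r → β r < W) {C' : ℕ → Finset ℕ} {k c j a cx : ℕ} (ha : 1 ≤ a)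
    (haC : a ∉ C (c + 1)) (hgap : ¬ Gap W k β C c a) (hjc : j ≤ c)
    (hfill : ∀ m, j < m → m ≤ c → a ∈ C m) {A : ℕ → ℕ} (H : RunSpec W k β C C' j a cx A) :
    RunSpec W k β C C' (c + 1) a cx (fun m => if m ≤ j then A m else a) := by
  have hj := H.two.trans H.le
  obtain ⟨R, hR, hRc⟩ : ∃ R, k ≤ R ∧ upper C R c a ≤ low W β C R (c + 1) a := by
    unfold Gap at hgap
    push Not at hgap
    obtain ⟨R, h1, h2⟩ := hgap
    exact ⟨R, h1, by omega⟩
  have hz : ∀ n m, m + n = c → j ≤ m → upper C R m a ≤ low W β C R (m + 1) (a + 1) := by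
    intro n
    induction n with
    | zero =>
      intro m hm _
      obtain rfl : m = c := hm
      have : low W β C R (m + 1) a ≤ low W β C R (m + 1) (a + 1) + _ := lower_step _ _ _ _ _
      rw [if_neg haC] at this
      omega
    | succ n ih =>
      intro m hm h1
      have i1 := ih (m + 1) (by omega) (by omega)
      have i2 := hG.low_le_upper hW R (by omega : 1 ≤ m + 1 + 1) (by omega : 1 ≤ a + 1)
      have i3 := upper_col C R (m + 1) (a + 1)
      have i4 := upper_rec C R m a
      rw [if_pos (hfill (m + 1) (by omega) (by omega))] at i4
      have i5 : low W β C R (m + 1 + 1) (a + 1) ≤ low W β C R (m + 1) (a + 1) :=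
        lower_col C (cntN_zero hW R) (cntN_anti β R) (m + 1) _
      omega
  have habove : ∀ m, j ≤ m → ∀ h, a < h → ∀ R, upper C' R m h = upper C R m h := by
    intro m h1
    induction m, h1 using Nat.le_induction with
    | base => intro h hh R; exact H.above j H.le le_rfl h (by rw [H.start]; exact hh) R
    | succ n hn ih =>
      intro h hh R
      exact upper_succ_congr (fun h' hh' => ih h' (by omega) R) fun g _ => by
        rw [H.out (n + 1) (Or.inr (by omega))]
  have hA : ∀ m, j ≤ m → (if m ≤ j then A m else a) = a := by
    intro m hm
    split_ifs with e
    · obtain rfl : m = j := by omega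
      exact H.start
    · rfl
  have hA' : ∀ m, m ≤ j → (if m ≤ j then A m else a) = A m := fun m hm => if_pos hm
  have hlec := H.le
  refine ⟨hA _ (by omega), fun m hm => ?_, ?_, H.two, by omega, fun m hm => ?_, fun m hm => ?_,
    ?_, ?_, ?_, fun _ => ⟨by omega, ?_, ?_⟩, ?_, ?_⟩
  · rw [hA' m (by omega)]; exact H.zero m hm
  · rw [hA' cx H.le]; exact H.pos
  · rcases lt_or_ge m j with h | h
    · rw [hA' m h.le, hA' (m + 1) h]; exact H.mono m h
    · rw [hA m h, hA (m + 1) (by omega)]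
  · exact H.out m (by omega)
  · intro m h1 h2
    rcases lt_or_ge m j with h | h
    · rw [hA' m h.le]; exact H.touch m h1 h
    · rw [hA m h]
      refine ⟨R, hR, ?_⟩
      rw [habove m h _ (by omega)]
      have e1 : low W β C' R (m + 1) (a + 1) = low W β C R (m + 1) (a + 1) :=
        low_congr hW R fun n hn g _ => by rw [H.out n (Or.inr (by omega))]
      rw [e1]
      exact (upper_anti C R m (Nat.le_succ a)).trans (hz (c - m) m (by omega) h)
  · intro m h1 h2 h g1 g2
    rcases le_or_gt m j with hm | hm
    · rw [hA' m hm] at g2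
      rw [hA' (m - 1) (by omega)] at g1
      exact H.gap m h1 hm h g1 g2
    · rw [hA (m - 1) (by omega)] at g1
      rw [hA m hm.le] at g2
      omega
  · intro m h1 h2 h g1 R
    rcases lt_or_ge m j with hm | hm
    · rw [hA' m hm.le] at g1
      exact H.above m h1 hm.le h g1 R
    · rw [hA m hm] at g1
      exact habove m hm h g1 R
  · exact hA _ (by omega)
  · exact H.out _ (Or.inr (by omega))
  · intro m h1 h2 h g1 g2
    rcases lt_or_ge m j with hm | hm
    · rw [hA' m hm.le] at g1
      rw [hA' (m + 1) hm] at g2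
      exact H.gap_before m h1 hm h g1 g2
    · rw [hA m hm] at g1
      rw [hA (m + 1) (by omega)] at g2
      omega
  · intro m h1 h2
    rcases lt_or_ge m j with hm | hm
    · rw [hA' m hm.le]
      exact H.not_gap m h1 hm
    · rw [hA m hm]
      intro hg
      have e1 := hg R hR
      have e2 := hz (c - m) m (by omega) hm
      have e3 : low W β C R (m + 1) (a + 1) ≤ low W β C R (m + 1) a :=
        lower_anti C (cntN_zero hW R) (cntN_anti β R) (m + 1) (Nat.le_succ a)
      omega

lemma Rect.exists_runSpec {k : ℕ} {β : ℕ → ℕ} {W : ℕ} (hW : ∀ r, 1 ≤ r → β r < W) {T U : Diagram}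
    {x z : Cell} (h : Rect k β T x U z) (hx : 1 ≤ x.2) (hxT : x ∉ T) :
    ∃ A, RunSpec W k β (col T) (col U) x.1 x.2 z.1 A ∧ A z.1 = z.2 := by
  induction h with
  | land T x α L r h hend =>
    obtain ⟨c, a⟩ := x
    have hc2 := h.2.2.2.2.2.2.1
    obtain ⟨c, rfl⟩ : ∃ c', c = c' + 1 := ⟨c - 1, by simp only at hc2; omega⟩
    obtain ⟨hG, hc, haC, hr, hrk, pos, hw, hF, h1, h2, h3⟩ := h.exists_words hx
    refine ⟨_, RunSpec.land hG.good hW hc hx haC (fun g g1 g2 => ?_) (fun m hm => ?_) ?_, ?_⟩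
    · exact Fam.gap hF hW hc hr hrk h1 (by have := h3.1 hend; omega) g2
    · rw [col_insert, if_neg hm]
    · rw [col_insert, if_pos rfl]
    · simp
  | bump T x α L r y h hnoland hy hyc hyl hlow U z hrec ih =>
    obtain ⟨c, a⟩ := x
    obtain ⟨c', b⟩ := y
    simp only at hyc
    subst hyc
    have hc2 := h.2.2.2.2.2.2.1
    obtain ⟨c, rfl⟩ : ∃ c'', c' = c'' + 1 := ⟨c' - 1, by simp only at hc2; omega⟩
    obtain ⟨hG, hc, haC, hr, hrk, pos, hw, hF, h1, h2, h3⟩ := h.exists_words hx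
    obtain ⟨_, hb1, hb⟩ := (hw.cell _ _ _).1 ⟨hy, hyl⟩
    simp only at hx
    have hba : b < a := by omega
    have hgap : ∀ g, b < g → g ≤ a → Gap W k β (col T) c g := fun g g1 g2 =>
      Fam.gap hF hW hc hr hrk h1 (by omega) g2
    have hnb := hG.bump_gap hW hc haC hba hb1 hgap hnoland hlow
    obtain ⟨A, hA, hAz⟩ := ih hb1 (by
      rw [Finset.mem_insert, Prod.mk.injEq]
      simp only [Finset.mem_erase]
      rintro (h | h)
      · omega
      · exact h.1 rfl)
    have hlt := (hA.stay (by
      rw [show (c + 1, b).1 - 1 = c from rfl]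
      intro hg
      apply hnb
      intro R hR
      have e := hg R hR
      have e1 : low W β (col (insert (c + 1, a) (T.erase (c + 1, b)))) R (c + 1) b =
          low W β (col T) R (c + 1) b := low_congr hW R fun n hn g hg => by
        rw [col_exchange]
        split_ifs with en
        · subst en
          have : g ≠ a := by omega
          have : g ≠ b := by omega
          simp only [Finset.mem_insert, Finset.mem_erase]
          tauto
        · rfl
      have e2 : upper (col (insert (c + 1, a) (T.erase (c + 1, b)))) R c b =
          upper (col T) R c b := upper_congr R fun n _ hn g _ => by
        rw [col_exchange, if_neg (by omega)]
      rwa [e1, e2] at e)).1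
    refine ⟨_, RunSpec.bump hG.good hW haC hba hgap hnb (fun m hm => ?_) ?_ hA, ?_⟩
    · rw [col_exchange, if_neg hm]
    · rw [col_exchange, if_pos rfl]
    · simp only at hlt ⊢
      rw [if_neg (by omega)]
      exact hAz
  | pass T x hno y hy hrow hcol hpos hfill U z hrec ih =>
    obtain ⟨c, a⟩ := x
    obtain ⟨j, b⟩ := y
    simp only at hrow hcol hpos hfill
    subst hrow
    obtain ⟨A, hA, hAz⟩ := ih hx hy
    have hG := hrec.goodD
    obtain ⟨c, rfl⟩ : ∃ c', c = c' + 1 := ⟨c - 1, by omega⟩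
    have haC : b ∉ col T (c + 1) := fun hm => hxT (mem_col.1 hm)
    refine ⟨_, RunSpec.pass hG.good hW hx haC (hG.not_gap hW (by omega) hx haC hno)
      (by omega) (fun m h1 h2 => mem_col.2 (hfill m h1 (by omega))) hA, ?_⟩
    have := hA.le
    simp only at this ⊢
    rw [if_pos this]
    exact hAz

lemma cnt_swaps (β : ℕ → ℕ) {r : ℕ} (hr : 1 ≤ r) (q : ℕ) (ρ : Fin (q + 1) → ℕ) (h0 : ρ 0 = r)
    (hρ : StrictMono ρ) (hβ : StrictMono fun i => β (ρ i)) :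
    β ((List.ofFn fun j : Fin q => Equiv.swap r (ρ j.succ)).prod r) = β (ρ (Fin.last q)) ∧
    (∀ s, ρ (Fin.last q) < s →
      β ((List.ofFn fun j : Fin q => Equiv.swap r (ρ j.succ)).prod s) = β s) ∧
    (∀ R m, cnt β R m ≤
      cnt (fun i => β ((List.ofFn fun j : Fin q => Equiv.swap r (ρ j.succ)).prod i)) R m) ∧
    (∀ R m, β (ρ (Fin.last q)) < m →
      cnt (fun i => β ((List.ofFn fun j : Fin q => Equiv.swap r (ρ j.succ)).prod i)) R m =
        cnt β R m) := by
  induction q with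
  | zero => simp [h0]
  | succ q ih =>
    obtain ⟨i1, i2, i3, i4⟩ := ih (fun i => ρ i.castSucc) h0
      (hρ.comp Fin.strictMono_castSucc) (hβ.comp Fin.strictMono_castSucc)
    have hprod : (List.ofFn fun j : Fin (q + 1) => Equiv.swap r (ρ j.succ)).prod =
        (List.ofFn fun j : Fin q => Equiv.swap r (ρ j.castSucc.succ)).prod *
          Equiv.swap r (ρ (Fin.last (q + 1))) := by
      rw [List.ofFn_succ_last, List.prod_append, List.prod_singleton, Fin.succ_last]
    have hlt : ρ (Fin.last q).castSucc < ρ (Fin.last (q + 1)) := hρ (Fin.castSucc_lt_last _)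
    have hltβ : β (ρ (Fin.last q).castSucc) < β (ρ (Fin.last (q + 1))) :=
      hβ (Fin.castSucc_lt_last _)
    have hrl : r < ρ (Fin.last (q + 1)) := h0 ▸ hρ (Fin.last_pos)
    simp only [Fin.succ_castSucc] at i1 i2 i3 i4 hprod
    set P := (List.ofFn fun j : Fin q => Equiv.swap r (ρ j.succ.castSucc)).prod with hP
    rw [hprod]
    simp only [Equiv.Perm.mul_apply]
    have i2' := i2 _ hlt
    refine ⟨?_, fun s hs => ?_, fun R m => (i3 R m).trans ?_, fun R m hm => ?_⟩
    · rw [Equiv.swap_apply_left, i2']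
    · rw [Equiv.swap_apply_of_ne_of_ne (by omega) (by omega), i2 s (by omega)]
    · have := cnt_swap (fun i => β (P i)) r (ρ (Fin.last (q + 1))) R m hr hrl
      simp only [i1, i2'] at this
      split_ifs at this <;> omega
    · rw [← i4 R m (by omega)]
      have := cnt_swap (fun i => β (P i)) r (ρ (Fin.last (q + 1))) R m hr hrl
      simp only [i1, i2'] at this
      split_ifs at this <;> omega

lemma KAddN.cnt_le {k : ℕ} {β γ : ℕ → ℕ} {c r : ℕ} (h : KAddN k β c r γ) (hr : 1 ≤ r)
    (hc : 1 ≤ c) (R m : ℕ) :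
    cnt β R m ≤ cnt γ R m ∧ (c < m → cnt γ R m = cnt β R m) := by
  obtain ⟨q, ρ, h0, hρ, hβ, hlast, -, rfl⟩ := h
  obtain ⟨i1, -, i3, i4⟩ := cnt_swaps β hr q ρ h0 hρ hβ
  set p : ℕ → ℕ := fun i => β ((List.ofFn fun j : Fin q => Equiv.swap r (ρ j.succ)).prod i) with hp
  have e : (fun i => β ((List.ofFn fun j : Fin q => Equiv.swap r (ρ j.succ)).prod i) +
      if i = r then 1 else 0) = Function.update p r (p r + 1) := by
    funext i
    by_cases hi : i = r
    · subst hi; simp [hp]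
    · simp [hp, hi]
  rw [e]
  have hpr : p r = c - 1 := i1.trans hlast
  have i5 := i3 R m
  have := cnt_update p r (p r + 1) R m hr
  refine ⟨?_, fun hm => ?_⟩
  · split_ifs at this <;> omega
  · rw [← i4 R m (by omega)]
    rw [if_neg (by omega), if_neg (by omega)] at this
    omega

lemma upper_le_upper_of_le (C : ℕ → Finset ℕ) (R : ℕ) {m n : ℕ} (h : m ≤ n) (g : ℕ) :
    upper C R n g ≤ upper C R m g := by
  induction n, h using Nat.le_induction with
  | base => exact le_rfl
  | succ n hn ih => exact (upper_col C R n g).trans ih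

/-- The row of a run is continued to the right of its starting column `j`. -/
lemma RunSpec.touch_all {W k : ℕ} {β γ : ℕ → ℕ} {C C' : ℕ → Finset ℕ} {j a cx : ℕ} {A : ℕ → ℕ}
    (hW : ∀ r, 1 ≤ r → β r < W) (hW' : ∀ r, 1 ≤ r → γ r < W)
    (hβγ : ∀ R m, cnt β R m ≤ cnt γ R m) (hj : C j = ∅)
    (H : RunSpec W k β C C' j a cx A) {c : ℕ} (hc : cx ≤ c) :
    ¬ Gap W k γ C' c (A (min c j) + 1) := by
  unfold Gap
  push Not
  have hcx := H.two
  rcases lt_or_ge c j with h | h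
  · obtain ⟨R, hR, h1⟩ := H.touch c hc h
    refine ⟨R, hR, ?_⟩
    have h2 : low W β C' R (c + 1) (A c + 1) ≤ low W γ C' R (c + 1) (A c + 1) :=
      lower_mono C' (cntN_zero hW R) (cntN_zero hW' R) _ fun n _ => hβγ R n
    rw [min_eq_left h.le]
    omega
  · refine ⟨k, le_rfl, ?_⟩
    rw [min_eq_right h]
    have h1 : upper C' k j (A j + 1) = 0 := by
      rw [H.above j H.le le_rfl _ (Nat.lt_succ_self _), upper_empty C k _ (by have := H.le; omega) hj]
    have h2 := upper_le_upper_of_le C' k h (A j + 1)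
    omega

lemma RunSpec.gap_of_cnt_eq {W k : ℕ} {β γ : ℕ → ℕ} {C C' : ℕ → Finset ℕ} {j a cx : ℕ}
    {A : ℕ → ℕ} (hW : ∀ r, 1 ≤ r → β r < W) (hW' : ∀ r, 1 ≤ r → γ r < W)
    (hβγ : ∀ R m, cx < m → cnt γ R m = cnt β R m)
    (H : RunSpec W k β C C' j a cx A) {m : ℕ} (hm : cx ≤ m) (hmj : m ≤ j) {h : ℕ}
    (h1 : A (m - 1) < h) (h2 : h ≤ A m) : Gap W k γ C' m h := by
  intro R hR
  have h3 : low W γ C' R (m + 1) h = low W β C' R (m + 1) h :=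
    lower_congr (cntN_zero hW' R) (cntN_zero hW R) (fun n hn => hβγ R n (by omega))
      fun _ _ _ _ => Iff.rfl
  rw [h3]
  exact H.gap m hm hmj h h1 h2 R hR

/-- Two successive runs, the second starting strictly above the first. -/
lemma RunSpec.lt_of_lt {W k : ℕ} {β γ : ℕ → ℕ} {C C' C'' : ℕ → Finset ℕ} {j j' a b cx cy : ℕ}
    {A B : ℕ → ℕ} (hW : ∀ r, 1 ≤ r → β r < W) (hW' : ∀ r, 1 ≤ r → γ r < W)
    (hβγ : ∀ R m, cnt β R m ≤ cnt γ R m) (hj : C j = ∅)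
    (HA : RunSpec W k β C C' j a cx A) (HB : RunSpec W k γ C' C'' j' b cy B) (hab : a < b) :
    cy ≤ cx ∧ (cy = cx → A cx < B cy) := by
  have key : ∀ n c, max j j' ≤ c + n → cx ≤ c → cy ≤ c + 1 → A (min c j) < B (min c j') := by
    intro n
    induction n with
    | zero =>
      intro c h _ _
      rw [min_eq_right (by omega), min_eq_right (by omega), HA.start, HB.start]
      exact hab
    | succ n ih =>
      intro c h hx hy
      have h1 := ih (c + 1) (by omega) (by omega) (by omega)
      have h2 : A (min c j) ≤ A (min (c + 1) j) := HA.mono' (by omega) (by omega)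
      rcases lt_or_ge c j' with hc | hc
      · by_contra hlt
        rw [min_eq_left hc.le] at hlt
        rw [min_eq_left (by omega : c + 1 ≤ j')] at h1
        exact HA.touch_all hW hW' hβγ hj hx
          (HB.gap_before c hy hc (A (min c j) + 1) (by omega) (by omega))
      · rw [min_eq_right (by omega : j' ≤ c + 1)] at h1
        rw [min_eq_right hc]
        omega
  have hle := HA.le
  have hle' := HB.le
  have hcy : cy ≤ cx := by
    by_contra hlt
    have := key (max j j') (cy - 1) (by omega) (by omega) (by omega)
    rw [min_eq_left (by omega : cy - 1 ≤ j'), HB.zero _ (by have := HB.two; omega)] at this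
    omega
  refine ⟨hcy, fun e => ?_⟩
  have := key (max j j') cx (by omega) le_rfl (by omega)
  rw [min_eq_left hle, min_eq_left (by omega)] at this
  rwa [e]

/-- Two successive runs, the second starting weakly below the first. -/
lemma RunSpec.lt_of_le {W k : ℕ} {β γ : ℕ → ℕ} {C C' C'' : ℕ → Finset ℕ} {j j' a b cx cy : ℕ}
    {A B : ℕ → ℕ} (hW : ∀ r, 1 ≤ r → β r < W) (hW' : ∀ r, 1 ≤ r → γ r < W)
    (hβγ : ∀ R m, cx < m → cnt γ R m = cnt β R m) (hj : C' j' = ∅)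
    (HA : RunSpec W k β C C' j a cx A) (HB : RunSpec W k γ C' C'' j' b cy B) (hba : b ≤ a) :
    cx < cy ∧ (cx + 1 = cy → B cy ≤ A cx) := by
  have hle := HA.le
  have hle' := HB.le
  have hx2 := HA.two
  have hnot : ∀ c, cy ≤ c → ¬ Gap W k γ C' c (B (min c j')) := by
    intro c hc hg
    rcases lt_or_ge c j' with h | h
    · rw [min_eq_left h.le] at hg
      exact HB.not_gap c hc h hg
    · have h1 := hg k le_rfl
      have h2 := upper_le_upper_of_le C' k h (B (min c j'))
      rw [upper_empty C' k _ (by have := HB.two; omega) hj] at h2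
      omega
  have key : ∀ n c, max j j' ≤ c + n → cx ≤ c + 1 → cy ≤ c + 1 →
      B (min (c + 1) j') ≤ A (min c j) := by
    intro n
    induction n with
    | zero =>
      intro c h _ _
      rw [min_eq_right (by omega), min_eq_right (by omega), HA.start, HB.start]
      exact hba
    | succ n ih =>
      intro c h hx hy
      have h1 := ih (c + 1) (by omega) (by omega) (by omega)
      have h2 : B (min (c + 1) j') ≤ B (min (c + 1 + 1) j') := HB.mono' (by omega) (by omega)
      rcases le_or_gt (c + 1) j with hc | hc
      · by_contra hlt
        rw [min_eq_left (by omega : c ≤ j)] at hlt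
        rw [min_eq_left hc] at h1
        exact hnot (c + 1) hy (HA.gap_of_cnt_eq hW hW' hβγ hx hc
          (by rw [Nat.add_sub_cancel]; omega) (by omega))
      · rw [min_eq_right (by omega : j ≤ c + 1)] at h1
        rw [min_eq_right (by omega : j ≤ c)]
        omega
  have hlt : cx < cy := by
    by_contra hcy
    have h1 := key (max j j') (cx - 1) (by omega) (by omega) (by omega)
    rw [min_eq_left (by omega : cx - 1 ≤ j), HA.zero _ (by omega)] at h1
    have h2 : B cy ≤ B (min (cx - 1 + 1) j') := HB.mono' (by omega) (by omega)
    have := HB.pos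
    omega
  refine ⟨hlt, fun e => ?_⟩
  have := key (max j j') cx (by omega) (by omega) (by omega)
  rwa [min_eq_left hle, min_eq_left (by omega), e] at this

/-- Row bumping lemma for restricted rectification. Let `S ∈ PKD(α)` (it has a
pinned proper labeling of shape `α`), let `T = S ←_{α,k} s` with landing cell
`x`, let `β` be the rectified labeling, and let `U = T ←_{β,k} t` with landing
cell `y`. If `s < t` then `x` lies weakly right of `y`, and strictly below `y`
if in the same column; if `s ≥ t` then `x` lies strictly left of `y`, and
weakly above `y` if in adjacent columns. -/
theorem row_bumping (k : ℕ) (α : ℕ → ℕ) (S : Diagram) (L : Cell → ℕ)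
    (hS : ProperLab S α L) (hpin : IsPinned S L)
    (s t : ℕ) (hs1 : 1 ≤ s) (hsk : s ≤ k) (ht1 : 1 ≤ t) (htk : t ≤ k)
    (cmax : ℕ) (hc : (∀ i, α i ≤ cmax) ∧ ∃ i, α i = cmax)
    (T : Diagram) (x : Cell) (h1 : Rect k α S (cmax + 1, s) T x)
    (β : ℕ → ℕ) (hβ : RectifiedLabel k α x.1 T β)
    (cmax' : ℕ) (hc' : (∀ i, β i ≤ cmax') ∧ ∃ i, β i = cmax')
    (U : Diagram) (y : Cell) (h2 : Rect k β T (cmax' + 1, t) U y) :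
    (s < t → (y.1 ≤ x.1 ∧ (y.1 = x.1 → x.2 < y.2))) ∧
    (t ≤ s → (x.1 < y.1 ∧ (x.1 + 1 = y.1 → y.2 ≤ x.2))) := by
  have hG := h1.goodD
  have hG' := h2.goodD
  obtain ⟨-, s', -, hadd, hk, -⟩ := hβ
  let W := max (cmax + 1) (cmax' + 1)
  have hW : ∀ r, 1 ≤ r → α r < W := fun r _ => by have := hc.1 r; omega
  have hW' : ∀ r, 1 ≤ r → β r < W := fun r _ => by have := hc'.1 r; omega
  have he : col S (cmax + 1) = ∅ := hG.good.empty (W := cmax + 1)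
    (fun r _ => Nat.lt_succ_of_le (hc.1 r)) (by omega) le_rfl
  have he' : col T (cmax' + 1) = ∅ := hG'.good.empty (W := cmax' + 1)
    (fun r _ => Nat.lt_succ_of_le (hc'.1 r)) (by omega) le_rfl
  obtain ⟨A, HA, hAx⟩ := h1.exists_runSpec hW hs1 fun h => by simp [← mem_col, he] at h
  obtain ⟨B, HB, hBy⟩ := h2.exists_runSpec hW' ht1 fun h => by simp [← mem_col, he'] at h
  have hcnt := hk.cnt_le hadd.1 hadd.2.2.1
  rw [← hAx, ← hBy]
  exact ⟨HA.lt_of_lt hW hW' (fun R m => (hcnt R m).1) he HB,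
    HA.lt_of_le hW hW' (fun R m => (hcnt R m).2) he' HB⟩
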